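/- Let D⊂ℝ^d be a bounded connected open domain with C³ boundary, Π an open set with Π̄⊂D, ν>0, T>0, ρ>0, and let a∈C(Q̄_T,ℝ^d) be continuously differentiable in x with sup_{Q_T}(|a| + |∇_x a|) ≤ ρ. Then for any q∈(0,1) there exists ε = ε(Π,T,q,ρ,ν,D) > 0 such that every NONNEGATIVE solution w∈C^{1,2}(Q̄_T) of ∂_t w − νΔw + div(a(t,x)w) = 0 with w|_{∂D}=0 satisfies either ‖w(T,·)‖_{L¹(D)} ≤ q‖w(0,·)‖_{L¹(D)}, or inf_{x∈Π} w(T,x) ≥ ε‖w(0,·)‖_{L¹(D)}. -/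

import Mathlib

open Set MeasureTheory Filter Topology

noncomputable section

/-- `d`-dimensional Euclidean space. -/
abbrev Euc (d : ℕ) : Type := EuclideanSpace ℝ (Fin d)

/-- The `j`-th vector of the standard basis. -/
def ebasis (d : ℕ) (j : Fin d) : Euc d := EuclideanSpace.single j 1

/-- Time derivative `∂ₜ u (t,x)`. -/
def dtt {d : ℕ} (u : ℝ → Euc d → ℝ) (t : ℝ) (x : Euc d) : ℝ := deriv (fun s => u s x) t

/-- First spatial differential. -/
def dx1 {d : ℕ} (f : Euc d → ℝ) (x : Euc d) : Euc d →L[ℝ] ℝ := fderiv ℝ f x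

/-- Second spatial differential. -/
def dx2 {d : ℕ} (f : Euc d → ℝ) (x : Euc d) : Euc d →L[ℝ] Euc d →L[ℝ] ℝ :=
  fderiv ℝ (fun y => fderiv ℝ f y) x

/-- Laplacian `Δf(x)`. -/
def lapl {d : ℕ} (f : Euc d → ℝ) (x : Euc d) : ℝ :=
  ∑ j : Fin d, dx2 f x (ebasis d j) (ebasis d j)

/-- `div_x A(f) (x) = Σⱼ ∂_{xⱼ} (Aⱼ(f x))`. -/
def divA {d : ℕ} (A : ℝ → Fin d → ℝ) (f : Euc d → ℝ) (x : Euc d) : ℝ :=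
  ∑ j : Fin d, fderiv ℝ (fun y => A (f y) j) x (ebasis d j)

/-- `div (a(t,·) w(t,·)) (x) = Σⱼ ∂_{xⱼ} (aⱼ(t,x) w(t,x))`. -/
def divAW {d : ℕ} (a : ℝ → Euc d → Euc d) (w : ℝ → Euc d → ℝ) (t : ℝ) (x : Euc d) : ℝ :=
  ∑ j : Fin d, fderiv ℝ (fun y => a t y j * w t y) x (ebasis d j)

/-- The boundary of `D` is of class `C³`: near each boundary point, `D` is the sublevel
set of a `C³` function with non-vanishing differential. -/
def HasC3Boundary {d : ℕ} (D : Set (Euc d)) : Prop :=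
  ∀ x ∈ frontier D, ∃ (U : Set (Euc d)) (ψ : Euc d → ℝ),
    IsOpen U ∧ x ∈ U ∧ ContDiff ℝ 3 ψ ∧ (∀ y ∈ U, fderiv ℝ ψ y ≠ 0) ∧
    D ∩ U = {y ∈ U | ψ y < 0}

/-- A bounded connected open domain with `C³` boundary. -/
def GoodDomain {d : ℕ} (D : Set (Euc d)) : Prop :=
  IsOpen D ∧ IsConnected D ∧ Bornology.IsBounded D ∧ HasC3Boundary D

/-- `u ∈ C^{1,2}(J × D̄)`: continuous on the closed cylinder, once continuously
differentiable in `t` and twice in `x`. -/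
def IsC12On {d : ℕ} (J : Set ℝ) (D : Set (Euc d)) (u : ℝ → Euc d → ℝ) : Prop :=
  ContinuousOn (fun p : ℝ × Euc d => u p.1 p.2) (J ×ˢ closure D) ∧
  (∀ x ∈ closure D, ∀ t ∈ J, DifferentiableAt ℝ (fun s => u s x) t) ∧
  (∀ t ∈ J, ∀ x ∈ closure D, DifferentiableAt ℝ (u t) x) ∧
  (∀ t ∈ J, ∀ x ∈ closure D, DifferentiableAt ℝ (fun y => fderiv ℝ (u t) y) x) ∧
  ContinuousOn (fun p : ℝ × Euc d => dtt u p.1 p.2) (J ×ˢ closure D) ∧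
  ContinuousOn (fun p : ℝ × Euc d => dx1 (u p.1) p.2) (J ×ˢ closure D) ∧
  ContinuousOn (fun p : ℝ × Euc d => dx2 (u p.1) p.2) (J ×ˢ closure D)

/-- `N` bounds both the sup-norm and the parabolic Hölder seminorm of exponent `γ`
of `f` on `J × D̄`. -/
def parHolderBound {d : ℕ} {Y : Type*} [NormedAddCommGroup Y] (γ : ℝ) (J : Set ℝ)
    (D : Set (Euc d)) (f : ℝ → Euc d → Y) (N : ℝ) : Prop :=
  (∀ t ∈ J, ∀ x ∈ closure D, ‖f t x‖ ≤ N) ∧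
  ∀ t₁ ∈ J, ∀ t₂ ∈ J, ∀ x₁ ∈ closure D, ∀ x₂ ∈ closure D,
    ‖f t₁ x₁ - f t₂ x₂‖ ≤ N * (|t₁ - t₂| ^ (γ / 2) + ‖x₁ - x₂‖ ^ γ)

/-- The parabolic Hölder norm `|||f|||_γ` on `J × D̄` (up to equivalence). -/
def parHolderNorm {d : ℕ} {Y : Type*} [NormedAddCommGroup Y] (γ : ℝ) (J : Set ℝ)
    (D : Set (Euc d)) (f : ℝ → Euc d → Y) : ℝ :=
  sInf {N : ℝ | 0 ≤ N ∧ parHolderBound γ J D f N}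

/-- `h ∈ C^{γ/2,γ}(J × D̄)`. -/
def MemParHolder {d : ℕ} (γ : ℝ) (J : Set ℝ) (D : Set (Euc d)) (h : ℝ → Euc d → ℝ) : Prop :=
  ContinuousOn (fun p : ℝ × Euc d => h p.1 p.2) (J ×ˢ closure D) ∧
  ∃ N, parHolderBound γ J D h N

/-- `N` bounds the `X^γ(J × D̄)` norm of `u`. -/
def XgammaBound {d : ℕ} (γ : ℝ) (J : Set ℝ) (D : Set (Euc d)) (u : ℝ → Euc d → ℝ)
    (N : ℝ) : Prop :=
  (∀ t ∈ J, ∀ x ∈ closure D, |u t x| ≤ N) ∧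
  parHolderBound γ J D (fun t x => dtt u t x) N ∧
  parHolderBound γ J D (fun t x => dx1 (u t) x) N ∧
  parHolderBound γ J D (fun t x => dx2 (u t) x) N

/-- The `X^γ(J × D̄)` norm (up to equivalence). -/
def XgammaNorm {d : ℕ} (γ : ℝ) (J : Set ℝ) (D : Set (Euc d)) (u : ℝ → Euc d → ℝ) : ℝ :=
  sInf {N : ℝ | 0 ≤ N ∧ XgammaBound γ J D u N}

/-- `u ∈ X^γ(J × D̄)`. -/
def MemXgamma {d : ℕ} (γ : ℝ) (J : Set ℝ) (D : Set (Euc d)) (u : ℝ → Euc d → ℝ) : Prop :=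
  IsC12On J D u ∧ ∃ N, XgammaBound γ J D u N

/-- `N` bounds the sup and the `γ`-Hölder seminorm of `f` on `S`. -/
def holderBoundOn {X Y : Type*} [NormedAddCommGroup X] [NormedAddCommGroup Y]
    (γ : ℝ) (S : Set X) (f : X → Y) (N : ℝ) : Prop :=
  (∀ x ∈ S, ‖f x‖ ≤ N) ∧ ∀ x ∈ S, ∀ y ∈ S, ‖f x - f y‖ ≤ N * ‖x - y‖ ^ γ

/-- `N` bounds the `C^{2+γ}(D̄)` norm of `g`. -/
def C2gammaBound {d : ℕ} (γ : ℝ) (D : Set (Euc d)) (g : Euc d → ℝ) (N : ℝ) : Prop :=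
  holderBoundOn γ (closure D) g N ∧
  holderBoundOn γ (closure D) (fun x => dx1 g x) N ∧
  holderBoundOn γ (closure D) (fun x => dx2 g x) N

/-- The `C^{2+γ}(D̄)` norm (up to equivalence). -/
def C2gammaNorm {d : ℕ} (γ : ℝ) (D : Set (Euc d)) (g : Euc d → ℝ) : ℝ :=
  sInf {N : ℝ | 0 ≤ N ∧ C2gammaBound γ D g N}

/-- `g ∈ C^{2+γ}(D̄)`. -/
def MemC2gamma {d : ℕ} (γ : ℝ) (D : Set (Euc d)) (g : Euc d → ℝ) : Prop :=
  (∀ x ∈ closure D, DifferentiableAt ℝ g x ∧ DifferentiableAt ℝ (fun y => fderiv ℝ g y) x) ∧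
  ∃ N, C2gammaBound γ D g N

/-- `u` satisfies `∂ₜu + div_x A(u) - ν Δu = h` for `t ∈ Jpde`, `x ∈ D`. -/
def SolvesPDE {d : ℕ} (ν : ℝ) (A : ℝ → Fin d → ℝ) (Jpde : Set ℝ) (D : Set (Euc d))
    (h u : ℝ → Euc d → ℝ) : Prop :=
  ∀ t ∈ Jpde, ∀ x ∈ D, dtt u t x + divA A (u t) x - ν * lapl (u t) x = h t x

/-- Homogeneous Dirichlet boundary condition on `J × ∂D`. -/
def DirichletBC {d : ℕ} (J : Set ℝ) (D : Set (Euc d)) (u : ℝ → Euc d → ℝ) : Prop :=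
  ∀ t ∈ J, ∀ x ∈ frontier D, u t x = 0

/-- The compatibility conditions on `∂D`. -/
def CompatCond {d : ℕ} (ν : ℝ) (A : ℝ → Fin d → ℝ) (D : Set (Euc d))
    (h : ℝ → Euc d → ℝ) (u₀ : Euc d → ℝ) : Prop :=
  ∀ x ∈ frontier D, u₀ x = 0 ∧ divA A u₀ x - ν * lapl u₀ x - h 0 x = 0

/-- The sign condition (S): `(Σⱼ Aⱼ'(u)) sgn u ≥ c|u| - C`. -/
def SignCondition {d : ℕ} (A : ℝ → Fin d → ℝ) (c C : ℝ) : Prop :=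
  ∀ u : ℝ, c * |u| - C ≤ (∑ j : Fin d, deriv (fun v => A v j) u) * Real.sign u

/-- The `L¹(D)` norm. -/
def L1norm {d : ℕ} (D : Set (Euc d)) (f : Euc d → ℝ) : ℝ := ∫ x in D, |f x|

/-- The `L^∞(D)` norm (of a bounded continuous function). -/
def supNorm {d : ℕ} (D : Set (Euc d)) (f : Euc d → ℝ) : ℝ :=
  sSup ((fun x => |f x|) '' closure D)

/-- The piecewise constant control from Theorem 2.2: `ξ(t) = ξₖ` for
`t ∈ [k - 1/2, k - 1/2 + τₖ)` (where `k - 1 ≤ t < k`, `k ≥ 1`) and `ξ(t) = 0` otherwise. -/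
def ctrl (ξs τs : ℕ → ℝ) (t : ℝ) : ℝ :=
  Set.indicator
    (Set.Ico (((⌊t⌋₊ + 1 : ℕ) : ℝ) - 1/2) ((((⌊t⌋₊ + 1 : ℕ) : ℝ) - 1/2) + τs (⌊t⌋₊ + 1)))
    (fun _ => ξs (⌊t⌋₊ + 1)) t

/-- `ξ` is piecewise constant on `[0, T]`. -/
def PiecewiseConstOn (ξ : ℝ → ℝ) (T : ℝ) : Prop :=
  ∃ n : ℕ, ∃ τ : ℕ → ℝ, τ 0 = 0 ∧ τ n = T ∧ (∀ k < n, τ k < τ (k + 1)) ∧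
    ∀ k < n, ∀ t ∈ Ico (τ k) (τ (k + 1)), ξ t = ξ (τ k)

/-- `u` is the solution of the controlled problem with control `ξ(t) φ(x)`: a continuous curve
in `C^{2+γ}(D̄)` satisfying the initial and boundary conditions and solving the PDE on every
interval of constancy of `ξ` (i.e. at every time at which `ξ` is locally constant). -/
def IsCtrlSolOn {d : ℕ} (γ ν : ℝ) (A : ℝ → Fin d → ℝ) (D : Set (Euc d))
    (h : ℝ → Euc d → ℝ) (φ : Euc d → ℝ) (ξ : ℝ → ℝ) (u₀ : Euc d → ℝ)
    (J Jo : Set ℝ) (u : ℝ → Euc d → ℝ) : Prop :=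
  ContinuousOn (fun p : ℝ × Euc d => u p.1 p.2) (J ×ˢ closure D) ∧
  (∀ t ∈ J, MemC2gamma γ D (u t)) ∧
  DirichletBC J D u ∧
  (∀ x ∈ closure D, u 0 x = u₀ x) ∧
  ∀ t ∈ Jo, (∀ᶠ s in nhds t, ξ s = ξ t) →
    (∀ x ∈ closure D, DifferentiableAt ℝ (fun s => u s x) t) ∧
    ∀ x ∈ D, dtt u t x + divA A (u t) x - ν * lapl (u t) x = h t x + ξ t * φ x

/-- The integral of a directional derivative of a compactly supported `C¹` function vanishes. -/
lemma setIntegral_fderiv_eq_zero {d : ℕ} {D K : Set (Euc d)} (hD : IsOpen D)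
    (hK : IsCompact K) (hKD : K ⊆ D) {f : Euc d → ℝ} {f' : Euc d → Euc d →L[ℝ] ℝ}
    (hf : ∀ x ∈ D, HasFDerivAt f (f' x) x) (hf' : ContinuousOn f' D)
    (h0 : ∀ x ∈ D, x ∉ K → f x = 0) (v : Euc d) : ∫ x in D, f' x v = 0 := by
  have hg : ∀ x, HasFDerivAt (D.indicator f) (D.indicator f' x) x := by
    intro x
    by_cases hx : x ∈ D
    · rw [indicator_of_mem hx]
      refine (hf x hx).congr_of_eventuallyEq ?_
      filter_upwards [hD.mem_nhds hx] with y hy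
      rw [indicator_of_mem hy]
    · rw [indicator_of_notMem hx]
      refine (hasFDerivAt_const (0 : ℝ) x).congr_of_eventuallyEq ?_
      filter_upwards [hK.isClosed.isOpen_compl.mem_nhds (fun h => hx (hKD h))] with y hy
      by_cases hy' : y ∈ D
      · rw [indicator_of_mem hy', h0 y hy' hy]
      · rw [indicator_of_notMem hy']
  have hg0 : ∀ x, x ∉ K → D.indicator f' x = 0 := by
    intro x hx
    have h1 : HasFDerivAt (D.indicator f) (0 : Euc d →L[ℝ] ℝ) x := by
      refine (hasFDerivAt_const (0 : ℝ) x).congr_of_eventuallyEq ?_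
      filter_upwards [hK.isClosed.isOpen_compl.mem_nhds hx] with y hy
      by_cases hy' : y ∈ D
      · rw [indicator_of_mem hy', h0 y hy' hy]
      · rw [indicator_of_notMem hy']
    exact (hg x).unique h1
  have hcont : Continuous (D.indicator f') := by
    rw [continuous_iff_continuousAt]
    intro x
    by_cases hx : x ∈ D
    · refine (hf'.continuousAt (hD.mem_nhds hx)).congr ?_
      filter_upwards [hD.mem_nhds hx] with y hy
      rw [indicator_of_mem hy]
    · refine (continuousAt_const (y := (0 : Euc d →L[ℝ] ℝ))).congr ?_
      filter_upwards [hK.isClosed.isOpen_compl.mem_nhds (fun h => hx (hKD h))] with y hy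
      exact (hg0 y hy).symm
  have hgK : ∀ x, x ∉ K → D.indicator f x = 0 := by
    intro x hx
    by_cases hy' : x ∈ D
    · rw [indicator_of_mem hy', h0 x hy' hx]
    · rw [indicator_of_notMem hy']
  have hdiff : Differentiable ℝ (D.indicator f) := fun x => (hg x).differentiableAt
  have hfd : ∀ x, fderiv ℝ (D.indicator f) x = D.indicator f' x := fun x => (hg x).fderiv
  have hint1 : Integrable (fun x => D.indicator f' x v) :=
    Continuous.integrable_of_hasCompactSupport (by fun_prop)
      (HasCompactSupport.intro hK (fun x hx => by rw [hg0 x hx]; rfl))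
  have hint2 : Integrable (D.indicator f) :=
    hdiff.continuous.integrable_of_hasCompactSupport (HasCompactSupport.intro hK hgK)
  have key := integral_mul_fderiv_eq_neg_fderiv_mul_of_integrable (μ := volume)
    (f := fun _ : Euc d => (1 : ℝ)) (g := D.indicator f) (v := v) (by simp)
    (by simpa [hfd] using hint1) (by simpa using hint2) (by fun_prop) (fun x _ => hdiff x)
  simp only [hfd, one_mul, fderiv_fun_const] at key
  rw [← integral_indicator hD.measurableSet]
  have : (D.indicator fun x => f' x v) = fun x => D.indicator f' x v := by
    ext x
    by_cases hx : x ∈ D <;> simp [hx]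
  rw [this, key]
  simp

/-- Differentiation under the integral sign, in integrated one-sided form. -/
lemma setIntegral_le_of_deriv_le {d : ℕ} {D : Set (Euc d)} (hD : IsOpen D)
    (hb : Bornology.IsBounded D) {t₁ t₂ E : ℝ} (ht : t₁ ≤ t₂) {f f' : ℝ → Euc d → ℝ}
    (hf : ∀ t ∈ Icc t₁ t₂, ∀ x ∈ D, HasDerivAt (fun s => f s x) (f' t x) t)
    (hc : ContinuousOn (fun p : ℝ × Euc d => f p.1 p.2) (Icc t₁ t₂ ×ˢ closure D))
    (hc' : ContinuousOn (fun p : ℝ × Euc d => f' p.1 p.2) (Icc t₁ t₂ ×ˢ closure D))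
    (hle : ∀ t ∈ Icc t₁ t₂, ∫ x in D, f' t x ≤ E) :
    ∫ x in D, f t₂ x ≤ (∫ x in D, f t₁ x) + E * (t₂ - t₁) := by
  have hcomp : IsCompact (Icc t₁ t₂ ×ˢ closure D) := isCompact_Icc.prod hb.isCompact_closure
  obtain ⟨C, hC⟩ := hcomp.exists_bound_of_continuousOn hc
  obtain ⟨C', hC'⟩ := hcomp.exists_bound_of_continuousOn hc'
  have hvol : volume D ≠ ⊤ := hb.measure_lt_top.ne
  have : IsFiniteMeasure (volume.restrict D) := ⟨by simpa using hb.measure_lt_top⟩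
  have hslice : ∀ {h : ℝ → Euc d → ℝ},
      ContinuousOn (fun p : ℝ × Euc d => h p.1 p.2) (Icc t₁ t₂ ×ˢ closure D) →
      ∀ t ∈ Icc t₁ t₂, ContinuousOn (h t) D := by
    intro h hh t htt
    exact hh.comp (f := fun x => (t, x)) (by fun_prop) (fun x hx => ⟨htt, subset_closure hx⟩)
  have hcontF : ContinuousOn (fun t => ∫ x in D, f t x) (Icc t₁ t₂) := by
    refine continuousOn_of_dominated (bound := fun _ => C) ?_ ?_ (integrable_const _) ?_
    · intro t htt
      exact (hslice hc t htt).aestronglyMeasurable hD.measurableSet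
    · intro t htt
      refine ae_restrict_of_forall_mem hD.measurableSet fun x hx => ?_
      exact hC (t, x) ⟨htt, subset_closure hx⟩
    · refine ae_restrict_of_forall_mem hD.measurableSet fun x hx => ?_
      exact hc.comp (f := fun t => (t, x)) (by fun_prop) (fun t htt => ⟨htt, subset_closure hx⟩)
  have hder : ∀ t ∈ Ioo t₁ t₂,
      HasDerivAt (fun t => ∫ x in D, f t x) (∫ x in D, f' t x) t := by
    intro t htt
    have hs : Ioo t₁ t₂ ∈ 𝓝 t := Ioo_mem_nhds htt.1 htt.2
    have hI : ∀ s ∈ Ioo t₁ t₂, s ∈ Icc t₁ t₂ := fun s hs => Ioo_subset_Icc_self hs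
    refine (hasDerivAt_integral_of_dominated_loc_of_deriv_le (bound := fun _ => C') hs
      ?_ ?_ ?_ ?_ (integrable_const _) ?_).2
    · filter_upwards [hs] with s hs'
      exact (hslice hc s (hI s hs')).aestronglyMeasurable hD.measurableSet
    · refine Integrable.of_bound ((hslice hc t (hI t htt)).aestronglyMeasurable
        hD.measurableSet) C ?_
      refine ae_restrict_of_forall_mem hD.measurableSet fun x hx => ?_
      exact hC (t, x) ⟨hI t htt, subset_closure hx⟩
    · exact (hslice hc' t (hI t htt)).aestronglyMeasurable hD.measurableSet
    · refine ae_restrict_of_forall_mem hD.measurableSet fun x hx s hs' => ?_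
      exact hC' (s, x) ⟨hI s hs', subset_closure hx⟩
    · refine ae_restrict_of_forall_mem hD.measurableSet fun x hx s hs' => ?_
      exact hf s (hI s hs') x hx
  have := (convex_Icc t₁ t₂).image_sub_le_mul_sub_of_deriv_le hcontF
    (by
      rw [interior_Icc]
      exact fun t htt => (hder t htt).differentiableAt.differentiableWithinAt)
    (C := E) (by
      rw [interior_Icc]
      intro t htt
      rw [(hder t htt).deriv]
      exact hle t (Ioo_subset_Icc_self htt)) t₁ (left_mem_Icc.2 ht) t₂ (right_mem_Icc.2 ht) ht
  linarith

/-- `u` is of class `C^{1,2}` on `J × D` with derivatives `ut`, `u1`, `u2` which extend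
continuously to `J × D̄`. -/
structure C12Data {d : ℕ} (J : Set ℝ) (D : Set (Euc d)) (u ut : ℝ → Euc d → ℝ)
    (u1 : ℝ → Euc d → Euc d →L[ℝ] ℝ) (u2 : ℝ → Euc d → Euc d →L[ℝ] Euc d →L[ℝ] ℝ) : Prop where
  hasDerivAt : ∀ t ∈ J, ∀ x ∈ D, HasDerivAt (fun s => u s x) (ut t x) t
  hasFDerivAt : ∀ t ∈ J, ∀ x ∈ D, HasFDerivAt (u t) (u1 t x) x
  hasFDerivAt₂ : ∀ t ∈ J, ∀ x ∈ D, HasFDerivAt (u1 t) (u2 t x) x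
  cont : ContinuousOn (fun p : ℝ × Euc d => u p.1 p.2) (J ×ˢ closure D)
  cont_t : ContinuousOn (fun p : ℝ × Euc d => ut p.1 p.2) (J ×ˢ closure D)
  cont₁ : ContinuousOn (fun p : ℝ × Euc d => u1 p.1 p.2) (J ×ˢ closure D)
  cont₂ : ContinuousOn (fun p : ℝ × Euc d => u2 p.1 p.2) (J ×ˢ closure D)

/-- Trace of a bilinear form. -/
def trace2 {d : ℕ} (L : Euc d →L[ℝ] Euc d →L[ℝ] ℝ) : ℝ :=
  ∑ j : Fin d, L (ebasis d j) (ebasis d j)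

/-- Trace of an endomorphism: the divergence of a vector field with differential `L`. -/
def traceEnd {d : ℕ} (L : Euc d →L[ℝ] Euc d) : ℝ := ∑ j : Fin d, L (ebasis d j) j

lemma sum_apply_ebasis_mul {d : ℕ} (L : Euc d →L[ℝ] ℝ) (v : Euc d) :
    ∑ j : Fin d, v j * L (ebasis d j) = L v := by
  conv_rhs => rw [← (EuclideanSpace.basisFun (Fin d) ℝ).sum_repr v]
  simp [ebasis, map_sum]

lemma norm_ebasis {d : ℕ} (j : Fin d) : ‖ebasis d j‖ = 1 := by simp [ebasis]

lemma abs_traceEnd_le {d : ℕ} (L : Euc d →L[ℝ] Euc d) : |traceEnd L| ≤ d * ‖L‖ := by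
  unfold traceEnd
  refine (Finset.abs_sum_le_sum_abs _ _).trans ?_
  refine (Finset.sum_le_sum (g := fun _ => ‖L‖) fun j _ => ?_).trans (by simp)
  have h1 : |L (ebasis d j) j| ≤ ‖L (ebasis d j)‖ := by
    simpa using PiLp.norm_apply_le (L (ebasis d j)) j
  have h2 := L.le_opNorm (ebasis d j)
  rw [norm_ebasis, mul_one] at h2
  exact h1.trans h2

namespace C12Data

variable {d : ℕ} {J J' : Set ℝ} {D : Set (Euc d)} {u ut : ℝ → Euc d → ℝ}
  {u1 : ℝ → Euc d → Euc d →L[ℝ] ℝ} {u2 : ℝ → Euc d → Euc d →L[ℝ] Euc d →L[ℝ] ℝ}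

lemma mono (h : C12Data J D u ut u1 u2) (hJ : J' ⊆ J) : C12Data J' D u ut u1 u2 where
  hasDerivAt t ht := h.hasDerivAt t (hJ ht)
  hasFDerivAt t ht := h.hasFDerivAt t (hJ ht)
  hasFDerivAt₂ t ht := h.hasFDerivAt₂ t (hJ ht)
  cont := h.cont.mono (prod_mono_left hJ)
  cont_t := h.cont_t.mono (prod_mono_left hJ)
  cont₁ := h.cont₁.mono (prod_mono_left hJ)
  cont₂ := h.cont₂.mono (prod_mono_left hJ)

lemma continuousOn_slice (h : C12Data J D u ut u1 u2) {t : ℝ} (ht : t ∈ J) :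
    ContinuousOn (u t) (closure D) :=
  h.cont.comp (f := fun x => (t, x)) (by fun_prop) (fun _ hx => ⟨ht, hx⟩)

lemma integrableOn (h : C12Data J D u ut u1 u2) (hb : Bornology.IsBounded D) {t : ℝ}
    (ht : t ∈ J) : IntegrableOn (u t) D :=
  ((h.continuousOn_slice ht).integrableOn_compact hb.isCompact_closure).mono_set subset_closure

set_option maxSynthPendingDepth 3 in
/-- Chain rule for `γ ∘ u`. -/
lemma comp (h : C12Data J D u ut u1 u2) {γ γ' γ'' : ℝ → ℝ}
    (h1 : ∀ z, HasDerivAt γ (γ' z) z) (h2 : ∀ z, HasDerivAt γ' (γ'' z) z)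
    (h3 : Continuous γ'') :
    C12Data J D (fun t x => γ (u t x)) (fun t x => γ' (u t x) * ut t x)
      (fun t x => γ' (u t x) • u1 t x)
      (fun t x => γ' (u t x) • u2 t x + (γ'' (u t x) • u1 t x).smulRight (u1 t x)) where
  hasDerivAt t ht x hx := (h1 (u t x)).comp t (h.hasDerivAt t ht x hx)
  hasFDerivAt t ht x hx := (h1 (u t x)).comp_hasFDerivAt x (h.hasFDerivAt t ht x hx)
  hasFDerivAt₂ t ht x hx :=
    ((h2 (u t x)).comp_hasFDerivAt x (h.hasFDerivAt t ht x hx)).smul (h.hasFDerivAt₂ t ht x hx)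
  cont := by
    have c1 : Continuous γ := continuous_iff_continuousAt.2 fun z => (h1 z).continuousAt
    exact c1.comp_continuousOn h.cont
  cont_t := by
    have c1 : Continuous γ' := continuous_iff_continuousAt.2 fun z => (h2 z).continuousAt
    exact (c1.comp_continuousOn h.cont).mul h.cont_t
  cont₁ := by
    have c1 : Continuous γ' := continuous_iff_continuousAt.2 fun z => (h2 z).continuousAt
    exact (c1.comp_continuousOn h.cont).smul h.cont₁
  cont₂ := by
    have c1 : Continuous γ' := continuous_iff_continuousAt.2 fun z => (h2 z).continuousAt
    refine ((c1.comp_continuousOn h.cont).smul h.cont₂).add ?_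
    have c3 : Continuous fun p : (Euc d →L[ℝ] ℝ) × (Euc d →L[ℝ] ℝ) => p.1.smulRight p.2 :=
      (ContinuousLinearMap.smulRightL ℝ (Euc d) (Euc d →L[ℝ] ℝ)).continuous₂
    exact c3.comp_continuousOn
      (((h3.comp_continuousOn h.cont).smul h.cont₁).prodMk h.cont₁)

lemma const (J : Set ℝ) (D : Set (Euc d)) (c : ℝ) :
    C12Data J D (fun _ _ => c) (fun _ _ => 0) (fun _ _ => 0) (fun _ _ => 0) where
  hasDerivAt t _ _ _ := hasDerivAt_const t c
  hasFDerivAt _ _ x _ := hasFDerivAt_const c x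
  hasFDerivAt₂ _ _ x _ := hasFDerivAt_const (0 : Euc d →L[ℝ] ℝ) x
  cont := continuousOn_const
  cont_t := continuousOn_const
  cont₁ := continuousOn_const
  cont₂ := continuousOn_const

end C12Data

lemma trace2_comp {d : ℕ} (c c' : ℝ) (L : Euc d →L[ℝ] ℝ) (M : Euc d →L[ℝ] Euc d →L[ℝ] ℝ) :
    trace2 (c • M + (c' • L).smulRight L) =
      c * trace2 M + c' * ∑ j : Fin d, L (ebasis d j) ^ 2 := by
  simp only [trace2, Finset.mul_sum, ← Finset.sum_add_distrib]
  refine Finset.sum_congr rfl fun j _ => ?_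
  simp
  ring

/-- Duality between `∂ₜ - νΔ + div(a ·)` and its adjoint. -/
lemma duality {d : ℕ} {D : Set (Euc d)} (hD : IsOpen D) (hb : Bornology.IsBounded D)
    {ν t₁ t₂ E : ℝ} (ht : t₁ ≤ t₂) {a : ℝ → Euc d → Euc d}
    (ha : ContinuousOn (fun p : ℝ × Euc d => a p.1 p.2) (Icc t₁ t₂ ×ˢ closure D))
    (had : ∀ t ∈ Icc t₁ t₂, ∀ x ∈ D, DifferentiableAt ℝ (a t) x)
    (ha' : ContinuousOn (fun p : ℝ × Euc d => fderiv ℝ (a p.1) p.2) (Icc t₁ t₂ ×ˢ closure D))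
    {u ut : ℝ → Euc d → ℝ} {u1 : ℝ → Euc d → Euc d →L[ℝ] ℝ}
    {u2 : ℝ → Euc d → Euc d →L[ℝ] Euc d →L[ℝ] ℝ}
    {φ φt : ℝ → Euc d → ℝ} {φ1 : ℝ → Euc d → Euc d →L[ℝ] ℝ}
    {φ2 : ℝ → Euc d → Euc d →L[ℝ] Euc d →L[ℝ] ℝ}
    (hu : C12Data (Icc t₁ t₂) D u ut u1 u2) (hφ : C12Data (Icc t₁ t₂) D φ φt φ1 φ2)
    (hsupp : ∀ t ∈ Icc t₁ t₂, ∃ K, IsCompact K ∧ K ⊆ D ∧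
      ((∀ x ∈ D, x ∉ K → u t x = 0) ∨ (∀ x ∈ D, x ∉ K → φ t x = 0)))
    (hle : ∀ t ∈ Icc t₁ t₂, ∀ x ∈ D,
      φ t x * (ut t x - ν * trace2 (u2 t x) + u1 t x (a t x) + u t x * traceEnd (fderiv ℝ (a t) x))
      + u t x * (φt t x + ν * trace2 (φ2 t x) + φ1 t x (a t x)) ≤ E) :
    ∫ x in D, u t₂ x * φ t₂ x ≤
      (∫ x in D, u t₁ x * φ t₁ x) + E * volume.real D * (t₂ - t₁) := by
  refine setIntegral_le_of_deriv_le hD hb ht (f := fun t x => u t x * φ t x)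
    (f' := fun t x => ut t x * φ t x + u t x * φt t x)
    (fun t htt x hx => (hu.hasDerivAt t htt x hx).mul (hφ.hasDerivAt t htt x hx))
    (hu.cont.mul hφ.cont) ((hu.cont_t.mul hφ.cont).add (hu.cont.mul hφ.cont_t)) ?_
  intro t htt
  obtain ⟨K, hK, hKD, hz⟩ := hsupp t htt
  have hfin : volume D ≠ ⊤ := hb.measure_lt_top.ne
  have slice : ∀ {Y : Type} [TopologicalSpace Y] {h : ℝ → Euc d → Y},
      ContinuousOn (fun p : ℝ × Euc d => h p.1 p.2) (Icc t₁ t₂ ×ˢ closure D) →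
      ContinuousOn (h t) (closure D) := fun hh =>
    hh.comp (f := fun x => (t, x)) (by fun_prop) (fun x hx => ⟨htt, hx⟩)
  have cu := slice hu.cont
  have cut := slice hu.cont_t
  have cu1 := slice hu.cont₁
  have cu2 := slice hu.cont₂
  have cφ := slice hφ.cont
  have cφt := slice hφ.cont_t
  have cφ1 := slice hφ.cont₁
  have cφ2 := slice hφ.cont₂
  have ca := slice ha
  have ca' := slice (h := fun t x => fderiv ℝ (a t) x) ha'
  -- the flux in direction `j` and its differential
  let V : Fin d → Euc d → ℝ := fun j x =>
    ν * (φ t x * u1 t x (ebasis d j) - u t x * φ1 t x (ebasis d j)) - (φ t x * u t x) * a t x j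
  let V' : Fin d → Euc d → Euc d →L[ℝ] ℝ := fun j x =>
    ν • ((φ t x • ((u2 t x).flip (ebasis d j)) + (u1 t x (ebasis d j)) • φ1 t x)
      - (u t x • ((φ2 t x).flip (ebasis d j)) + (φ1 t x (ebasis d j)) • u1 t x))
    - ((φ t x * u t x) • ((EuclideanSpace.proj j).comp (fderiv ℝ (a t) x))
      + (a t x j) • (φ t x • u1 t x + u t x • φ1 t x))
  have happ : ∀ (L : Euc d → Euc d →L[ℝ] ℝ) (L' : Euc d →L[ℝ] Euc d →L[ℝ] ℝ) (x v : Euc d),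
      HasFDerivAt L L' x → HasFDerivAt (fun y => L y v) (L'.flip v) x := by
    intro L L' x v h
    exact (h.clm_apply (hasFDerivAt_const v x)).congr_fderiv (by ext; simp)
  have hV : ∀ j, ∀ x ∈ D, HasFDerivAt (V j) (V' j x) x := by
    intro j x hx
    have d0 := hu.hasFDerivAt t htt x hx
    have d1 := happ _ _ x (ebasis d j) (hu.hasFDerivAt₂ t htt x hx)
    have e0 := hφ.hasFDerivAt t htt x hx
    have e1 := happ _ _ x (ebasis d j) (hφ.hasFDerivAt₂ t htt x hx)
    have f0 : HasFDerivAt (fun y => a t y j)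
        ((EuclideanSpace.proj j : Euc d →L[ℝ] ℝ).comp (fderiv ℝ (a t) x)) x :=
      (EuclideanSpace.proj j : Euc d →L[ℝ] ℝ).hasFDerivAt.comp x
        (had t htt x hx).hasFDerivAt
    exact (((e0.mul d1).sub (d0.mul e1)).const_mul ν).sub ((e0.mul d0).mul f0)
  have cV' : ∀ j, ContinuousOn (V' j) (closure D) := by
    intro j
    have k1 : ContinuousOn (fun x => (u2 t x).flip (ebasis d j)) (closure D) :=
      ((ContinuousLinearMap.apply ℝ (Euc d →L[ℝ] ℝ) (ebasis d j)).comp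
        (ContinuousLinearMap.flipₗᵢ ℝ (Euc d) (Euc d) ℝ).toContinuousLinearEquiv.toContinuousLinearMap).continuous.comp_continuousOn cu2
    have k2 : ContinuousOn (fun x => (φ2 t x).flip (ebasis d j)) (closure D) :=
      ((ContinuousLinearMap.apply ℝ (Euc d →L[ℝ] ℝ) (ebasis d j)).comp
        (ContinuousLinearMap.flipₗᵢ ℝ (Euc d) (Euc d) ℝ).toContinuousLinearEquiv.toContinuousLinearMap).continuous.comp_continuousOn cφ2
    have k3 : ContinuousOn (fun x => a t x j) (closure D) :=
      (EuclideanSpace.proj j : Euc d →L[ℝ] ℝ).continuous.comp_continuousOn ca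
    have k4 : ContinuousOn (fun x => (EuclideanSpace.proj j : Euc d →L[ℝ] ℝ).comp
        (fderiv ℝ (a t) x)) (closure D) := continuousOn_const.clm_comp ca'
    have k5 : ContinuousOn (fun x => u1 t x (ebasis d j)) (closure D) :=
      cu1.clm_apply continuousOn_const
    have k6 : ContinuousOn (fun x => φ1 t x (ebasis d j)) (closure D) :=
      cφ1.clm_apply continuousOn_const
    exact ((((cφ.smul k1).add (k5.smul cφ1)).sub ((cu.smul k2).add (k6.smul cu1))).const_smul ν).sub
      (((cφ.mul cu).smul k4).add (k3.smul ((cφ.smul cu1).add (cu.smul cφ1))))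
  have hder0 : ∀ (f : Euc d → ℝ) (f' : Euc d →L[ℝ] ℝ) (x : Euc d), x ∈ D → x ∉ K →
      (∀ x ∈ D, x ∉ K → f x = 0) → HasFDerivAt f f' x → f' = 0 := by
    intro f f' x hx hxK h0 hf
    refine hf.unique ((hasFDerivAt_const (0 : ℝ) x).congr_of_eventuallyEq ?_)
    filter_upwards [hD.mem_nhds hx, hK.isClosed.isOpen_compl.mem_nhds hxK] with y h1 h2
    exact h0 y h1 h2
  have hV0 : ∀ j, ∀ x ∈ D, x ∉ K → V j x = 0 := by
    intro j x hx hxK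
    rcases hz with h | h
    · simp [V, h x hx hxK, hder0 _ _ x hx hxK h (hu.hasFDerivAt t htt x hx)]
    · simp [V, h x hx hxK, hder0 _ _ x hx hxK h (hφ.hasFDerivAt t htt x hx)]
  have hzero : ∀ j, ∫ x in D, V' j x (ebasis d j) = 0 := fun j =>
    setIntegral_fderiv_eq_zero hD hK hKD (hV j) ((cV' j).mono subset_closure) (hV0 j) _
  have hcint : ∀ {h : Euc d → ℝ}, ContinuousOn h (closure D) → IntegrableOn h D := fun hh =>
    (hh.integrableOn_compact hb.isCompact_closure).mono_set subset_closure
  have hVint : ∀ j, IntegrableOn (fun x => V' j x (ebasis d j)) D := fun j =>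
    hcint ((cV' j).clm_apply continuousOn_const)
  have hfint : IntegrableOn (fun x => ut t x * φ t x + u t x * φt t x) D :=
    hcint ((cut.mul cφ).add (cu.mul cφt))
  have hsum : ∫ x in D, ∑ j, V' j x (ebasis d j) = 0 := by
    rw [integral_finsetSum _ fun j _ => hVint j]
    simp [hzero]
  have hpt : ∀ x ∈ D, ut t x * φ t x + u t x * φt t x - ∑ j, V' j x (ebasis d j) ≤ E := by
    intro x hx
    refine le_trans (le_of_eq ?_) (hle t htt x hx)
    rw [← sum_apply_ebasis_mul (u1 t x) (a t x), ← sum_apply_ebasis_mul (φ1 t x) (a t x)]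
    have : ∀ j, V' j x (ebasis d j) = ν * φ t x * (u2 t x (ebasis d j) (ebasis d j))
        - ν * u t x * (φ2 t x (ebasis d j) (ebasis d j))
        - φ t x * u t x * (fderiv ℝ (a t) x (ebasis d j) j)
        - φ t x * (a t x j * u1 t x (ebasis d j)) - u t x * (a t x j * φ1 t x (ebasis d j)) := by
      intro j
      simp [V']
      ring
    simp only [this, Finset.sum_sub_distrib, ← Finset.mul_sum, trace2, traceEnd]
    ring
  calc ∫ x in D, (ut t x * φ t x + u t x * φt t x)
      = ∫ x in D, (ut t x * φ t x + u t x * φt t x - ∑ j, V' j x (ebasis d j)) := by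
        rw [integral_sub hfint
          (integrable_finsetSum _ fun j _ => hVint j), hsum, sub_zero]
    _ ≤ ∫ _ in D, E := by
        refine setIntegral_mono_on ?_ (integrableOn_const hfin) hD.measurableSet hpt
        exact hfint.sub
          (integrable_finsetSum _ fun j _ => hVint j)
    _ = E * volume.real D := by simp [mul_comm]

lemma hasDerivAt_comp_max_zero {F F' : ℝ → ℝ} (h : ∀ z, HasDerivAt F (F' z) z)
    (hc : Continuous F') (h0 : F' 0 = 0) (z : ℝ) :
    HasDerivAt (fun z => F (max z 0)) (F' (max z 0)) z := by
  have hF : Continuous F := continuous_iff_continuousAt.2 fun z => (h z).continuousAt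
  have hne : ∀ y, y ≠ 0 → HasDerivAt (fun z => F (max z 0)) (F' (max y 0)) y := by
    intro y hy
    rcases lt_or_gt_of_ne hy with hy | hy
    · rw [max_eq_right hy.le, h0]
      refine (hasDerivAt_const y (F 0)).congr_of_eventuallyEq ?_
      filter_upwards [eventually_lt_nhds hy] with x hx
      rw [max_eq_right hx.le]
    · rw [max_eq_left hy.le]
      refine (h y).congr_of_eventuallyEq ?_
      filter_upwards [eventually_gt_nhds hy] with x hx
      rw [max_eq_left hx.le]
  by_cases hz : z = 0
  · subst hz
    exact hasDerivAt_of_hasDerivAt_of_ne (g := fun y => F' (max y 0)) hne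
      (by fun_prop) (by fun_prop)
  · exact hne z hz

/-- A convex `C²` regularisation of the positive part. -/
def softPos (z : ℝ) : ℝ := max z 0 - Real.arctan (max z 0)

/-- The derivative of `softPos`. -/
def softPos' (z : ℝ) : ℝ := 1 - 1 / (1 + max z 0 ^ 2)

/-- The second derivative of `softPos`. -/
def softPos'' (z : ℝ) : ℝ := 2 * max z 0 / (1 + max z 0 ^ 2) ^ 2

lemma hasDerivAt_softPos (z : ℝ) : HasDerivAt softPos (softPos' z) z :=
  hasDerivAt_comp_max_zero (F := fun z => z - Real.arctan z) (F' := fun z => 1 - 1 / (1 + z ^ 2))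
    (fun z => (hasDerivAt_id z).sub (Real.hasDerivAt_arctan z))
    (by
      refine continuous_const.sub (continuous_const.div (by fun_prop) fun z => ?_)
      positivity) (by norm_num) z

lemma hasDerivAt_softPos' (z : ℝ) : HasDerivAt softPos' (softPos'' z) z := by
  refine hasDerivAt_comp_max_zero (F := fun z => 1 - 1 / (1 + z ^ 2))
    (F' := fun z => 2 * z / (1 + z ^ 2) ^ 2) (fun z => ?_) ?_ (by norm_num) z
  · have h1 : HasDerivAt (fun z : ℝ => 1 + z ^ 2) (2 * z) z := by
      simpa using (hasDerivAt_pow 2 z).const_add 1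
    have h2 := (h1.inv (by positivity)).const_sub 1
    simpa [one_div, neg_div] using h2
  · refine Continuous.div (by fun_prop) (by fun_prop) fun z => ?_
    positivity

lemma continuous_softPos'' : Continuous softPos'' := by
  unfold softPos''
  refine Continuous.div (by fun_prop) (by fun_prop) fun z => ?_
  positivity

lemma softPos'_nonneg (z : ℝ) : 0 ≤ softPos' z := by
  unfold softPos'
  have : 1 / (1 + max z 0 ^ 2) ≤ 1 := by
    rw [div_le_one (by positivity)]
    nlinarith [sq_nonneg (max z 0)]
  linarith

lemma softPos''_nonneg (z : ℝ) : 0 ≤ softPos'' z := by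
  unfold softPos''
  have : 0 ≤ max z 0 := le_max_right _ _
  positivity

lemma softPos_of_nonpos {z : ℝ} (hz : z ≤ 0) : softPos z = 0 := by
  simp [softPos, max_eq_right hz]

lemma monotone_softPos : Monotone softPos := by
  refine monotone_of_deriv_nonneg (fun z => (hasDerivAt_softPos z).differentiableAt) fun z => ?_
  rw [(hasDerivAt_softPos z).deriv]
  exact softPos'_nonneg z

lemma softPos_nonneg (z : ℝ) : 0 ≤ softPos z := by
  rw [← softPos_of_nonpos (min_le_right z 0)]
  exact monotone_softPos (min_le_left z 0)

lemma softPos_le_max (z : ℝ) : softPos z ≤ max z 0 := by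
  unfold softPos
  have := Real.arctan_nonneg.2 (le_max_right z 0)
  linarith

lemma softPos_pos {z : ℝ} (hz : 0 < z) : 0 < softPos z := by
  unfold softPos
  rw [max_eq_left hz.le]
  have := Real.lt_tan (Real.arctan_pos.2 hz) (Real.arctan_lt_pi_div_two z)
  rw [Real.tan_arctan] at this
  linarith

lemma le_softPos (z : ℝ) : z ≤ softPos z + 2 := by
  unfold softPos
  have h1 := Real.arctan_lt_pi_div_two (max z 0)
  have h2 := Real.pi_lt_four
  have h3 := le_max_left z 0
  linarith

lemma abs_softPos_sub_le (z : ℝ) : |softPos z - softPos' z * (z + 1)| ≤ 3 := by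
  rcases le_total z 0 with hz | hz
  · simp [softPos_of_nonpos hz, softPos', max_eq_right hz]
  · unfold softPos softPos'
    rw [max_eq_left hz]
    have h1 := Real.arctan_lt_pi_div_two z
    have h2 := Real.pi_lt_four
    have h3 := Real.arctan_nonneg.2 hz
    have h4 : z - Real.arctan z - (1 - 1 / (1 + z ^ 2)) * (z + 1)
        = -Real.arctan z + (z + 1) / (1 + z ^ 2) - 1 := by
      field_simp
      ring
    have h5 : 0 ≤ (z + 1) / (1 + z ^ 2) := by positivity
    have h6 : (z + 1) / (1 + z ^ 2) ≤ 2 := by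
      rw [div_le_iff₀ (by positivity)]
      nlinarith [sq_nonneg (z - 1), sq_nonneg z]
    rw [h4, abs_le]
    constructor <;> linarith

/-- Nonnegative solutions of `∂ₜw - νΔw + div(a w) = 0` with Dirichlet boundary condition, with the
equation written in nondivergence form. -/
structure IsSol {d : ℕ} (D : Set (Euc d)) (ν T ρ : ℝ) (a : ℝ → Euc d → Euc d)
    (w : ℝ → Euc d → ℝ) : Prop where
  a_cont : ContinuousOn (fun p : ℝ × Euc d => a p.1 p.2) (Icc 0 T ×ˢ closure D)
  a_diff : ∀ t ∈ Icc (0:ℝ) T, ∀ x ∈ closure D, DifferentiableAt ℝ (a t) x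
  a_cont' : ContinuousOn (fun p : ℝ × Euc d => fderiv ℝ (a p.1) p.2) (Icc 0 T ×ˢ closure D)
  a_le : ∀ t ∈ Icc (0:ℝ) T, ∀ x ∈ D, ‖a t x‖ + ‖fderiv ℝ (a t) x‖ ≤ ρ
  data : C12Data (Icc 0 T) D w (fun t x => dtt w t x) (fun t x => dx1 (w t) x)
    (fun t x => dx2 (w t) x)
  nonneg : ∀ t ∈ Icc (0:ℝ) T, ∀ x ∈ closure D, 0 ≤ w t x
  pde : ∀ t ∈ Icc (0:ℝ) T, ∀ x ∈ D, dtt w t x - ν * trace2 (dx2 (w t) x) + dx1 (w t) x (a t x)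
    + w t x * traceEnd (fderiv ℝ (a t) x) = 0
  bc : DirichletBC (Icc 0 T) D w

lemma C12Data.exists_bound {d : ℕ} {J : Set ℝ} {D : Set (Euc d)} {u ut : ℝ → Euc d → ℝ}
    {u1 : ℝ → Euc d → Euc d →L[ℝ] ℝ} {u2 : ℝ → Euc d → Euc d →L[ℝ] Euc d →L[ℝ] ℝ}
    (h : C12Data J D u ut u1 u2) (hJ : IsCompact J) (hb : Bornology.IsBounded D) :
    ∃ C, 0 ≤ C ∧ ∀ t ∈ J, ∀ x ∈ closure D, |u t x| ≤ C := by
  obtain ⟨C, hC⟩ := (hJ.prod hb.isCompact_closure).exists_bound_of_continuousOn h.cont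
  exact ⟨max C 0, le_max_right _ _, fun t ht x hx => (hC (t, x) ⟨ht, hx⟩).trans (le_max_left _ _)⟩

namespace IsSol

variable {d : ℕ} {D : Set (Euc d)} {ν T ρ : ℝ} {a : ℝ → Euc d → Euc d} {w : ℝ → Euc d → ℝ}
  {t₁ t₂ : ℝ} {φ φt : ℝ → Euc d → ℝ} {φ1 : ℝ → Euc d → Euc d →L[ℝ] ℝ}
  {φ2 : ℝ → Euc d → Euc d →L[ℝ] Euc d →L[ℝ] ℝ}

lemma integral_mul_le_of_subsolution (h : IsSol D ν T ρ a w) (hD : IsOpen D)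
    (hb : Bornology.IsBounded D)
    (h0 : 0 ≤ t₁) (h12 : t₁ ≤ t₂) (hT : t₂ ≤ T) (hφ : C12Data (Icc t₁ t₂) D φ φt φ1 φ2)
    (hsupp : ∀ t ∈ Icc t₁ t₂, ∃ K, IsCompact K ∧ K ⊆ D ∧ ∀ x ∈ D, x ∉ K → φ t x = 0)
    (hsub : ∀ t ∈ Icc t₁ t₂, ∀ x ∈ D, 0 ≤ φt t x + ν * trace2 (φ2 t x) + φ1 t x (a t x)) :
    ∫ x in D, w t₁ x * φ t₁ x ≤ ∫ x in D, w t₂ x * φ t₂ x := by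
  have hI : Icc t₁ t₂ ⊆ Icc 0 T := Icc_subset_Icc h0 hT
  have hneg := hφ.comp (γ := fun z => -z) (γ' := fun _ => -1) (γ'' := fun _ => 0)
    (fun z => hasDerivAt_neg z) (fun z => hasDerivAt_const z (-1 : ℝ)) continuous_const
  have := duality hD hb (ν := ν) (E := 0) h12 (h.a_cont.mono (prod_mono_left hI))
    (fun t ht x hx => h.a_diff t (hI ht) x (subset_closure hx))
    (h.a_cont'.mono (prod_mono_left hI)) (h.data.mono hI) hneg
    (fun t ht => by
      obtain ⟨K, hK, hKD, hz⟩ := hsupp t ht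
      exact ⟨K, hK, hKD, Or.inr fun x hx hxK => by simp [hz x hx hxK]⟩)
    (fun t ht x hx => by
      simp only [h.pde t (hI ht) x hx, trace2_comp]
      have h1 := hsub t ht x hx
      have h2 := h.nonneg t (hI ht) x (subset_closure hx)
      simp only [smul_apply, smul_eq_mul]
      nlinarith)
  simp only [mul_neg, integral_neg, zero_mul, add_zero] at this
  linarith

lemma integral_mul_le_of_supersolution (h : IsSol D ν T ρ a w) (hν : 0 < ν) (hD : IsOpen D)
    (hb : Bornology.IsBounded D)
    (h0 : 0 ≤ t₁) (h12 : t₁ ≤ t₂) (hT : t₂ ≤ T) (hφ : C12Data (Icc t₁ t₂) D φ φt φ1 φ2)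
    (hφ0 : ∀ t ∈ Icc t₁ t₂, ∀ x ∈ D, 0 ≤ φ t x)
    (hsup : ∀ t ∈ Icc t₁ t₂, ∀ x ∈ D, φt t x + ν * trace2 (φ2 t x) + φ1 t x (a t x) ≤ 0) :
    ∫ x in D, w t₂ x * φ t₂ x ≤ ∫ x in D, w t₁ x * φ t₁ x := by
  have hI : Icc t₁ t₂ ⊆ Icc 0 T := Icc_subset_Icc h0 hT
  obtain ⟨C, hC0, hC⟩ := hφ.exists_bound isCompact_Icc hb
  have hfin : volume D ≠ ⊤ := hb.measure_lt_top.ne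
  have hcint : ∀ {h : Euc d → ℝ}, ContinuousOn h (closure D) → IntegrableOn h D := fun hh =>
    (hh.integrableOn_compact hb.isCompact_closure).mono_set subset_closure
  have hρ : ∀ t ∈ Icc t₁ t₂, ∀ x ∈ D, |traceEnd (fderiv ℝ (a t) x)| ≤ d * ρ := by
    intro t ht x hx
    refine (abs_traceEnd_le _).trans ?_
    have h1 := h.a_le t (hI ht) x hx
    have h2 := norm_nonneg (a t x)
    gcongr
    linarith
  have m1 : t₁ ∈ Icc t₁ t₂ := left_mem_Icc.2 h12
  have m2 : t₂ ∈ Icc t₁ t₂ := right_mem_Icc.2 h12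
  set B : ℝ := 3 * (d * |ρ|) * C * volume.real D * (t₂ - t₁) + 3 * C * volume.real D with hB
  have hB0 : 0 ≤ B := by
    have : 0 ≤ t₂ - t₁ := by linarith
    positivity
  have key : ∀ κ : ℝ, 0 < κ →
      ∫ x in D, w t₂ x * φ t₂ x ≤ (∫ x in D, w t₁ x * φ t₁ x) + B * κ := by
    intro κ hκ
    let γ : ℝ → ℝ := fun z => κ * softPos (z / κ - 1)
    have dlin : ∀ z : ℝ, HasDerivAt (fun z : ℝ => z / κ - 1) (1 / κ) z := fun z =>
      ((hasDerivAt_id z).div_const κ).sub_const 1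
    have hu := (h.data.mono hI).comp (γ := γ) (γ' := fun z => softPos' (z / κ - 1))
      (γ'' := fun z => softPos'' (z / κ - 1) * (1 / κ))
      (fun z => by
        have := ((hasDerivAt_softPos (z / κ - 1)).comp z (dlin z)).const_mul κ
        refine this.congr_deriv ?_
        field_simp)
      (fun z => HasDerivAt.comp (h₂ := softPos') z (hasDerivAt_softPos' (z / κ - 1)) (dlin z))
      ((continuous_softPos''.comp (by fun_prop)).mul continuous_const)
    have hγ1 : ∀ z, 0 ≤ z → γ z ≤ z := by
      intro z hz
      have h1 := softPos_le_max (z / κ - 1)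
      have h2 : max (z / κ - 1) 0 ≤ z / κ := max_le (by linarith) (by positivity)
      calc γ z ≤ κ * (z / κ) := by simp only [γ]; gcongr; exact h1.trans h2
        _ = z := by field_simp
    have hγ2 : ∀ z, z ≤ γ z + 3 * κ := by
      intro z
      have h1 := le_softPos (z / κ - 1)
      calc z = κ * (z / κ) := by field_simp
        _ ≤ κ * (softPos (z / κ - 1) + 3) := by gcongr; linarith
        _ = γ z + 3 * κ := by simp only [γ]; ring
    have hγ3 : ∀ z, |γ z - softPos' (z / κ - 1) * z| ≤ 3 * κ := by
      intro z
      have h1 := abs_softPos_sub_le (z / κ - 1)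
      have : γ z - softPos' (z / κ - 1) * z
          = κ * (softPos (z / κ - 1) - softPos' (z / κ - 1) * (z / κ - 1 + 1)) := by
        simp only [γ]
        field_simp
        ring
      rw [this, abs_mul, abs_of_pos hκ]
      nlinarith
    have hd := duality hD hb (ν := ν) (E := 3 * κ * (d * |ρ|) * C) h12
      (h.a_cont.mono (prod_mono_left hI))
      (fun t ht x hx => h.a_diff t (hI ht) x (subset_closure hx))
      (h.a_cont'.mono (prod_mono_left hI)) hu hφ
      (fun t ht => by
        have hc := h.data.continuousOn_slice (hI ht)
        refine ⟨closure D ∩ w t ⁻¹' Ici κ, ?_, ?_, Or.inl ?_⟩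
        · exact hb.isCompact_closure.of_isClosed_subset
            (hc.preimage_isClosed_of_isClosed isClosed_closure isClosed_Ici) inter_subset_left
        · rintro x ⟨hx, hxκ⟩
          by_contra hxD
          have : x ∈ frontier D := ⟨hx, by rwa [hD.interior_eq]⟩
          have h1 := h.bc t (hI ht) x this
          simp only [mem_preimage, mem_Ici] at hxκ
          linarith
        · intro x hx hxK
          have : w t x < κ := by
            by_contra hcon
            exact hxK ⟨subset_closure hx, not_lt.1 hcon⟩
          have h1 : w t x / κ - 1 ≤ 0 := by
            rw [sub_nonpos, div_le_one hκ]; exact this.le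
          simp [γ, softPos_of_nonpos h1])
      (fun t ht x hx => by
        simp only [trace2_comp]
        have p1 := h.pde t (hI ht) x hx
        have p2 := hsup t ht x hx
        have p3 := h.nonneg t (hI ht) x (subset_closure hx)
        have p4 := hφ0 t ht x hx
        have p5 := (le_abs_self _).trans (hC t ht x (subset_closure hx))
        have p6 : 0 ≤ γ (w t x) := mul_nonneg hκ.le (softPos_nonneg _)
        have p7 := hγ3 (w t x)
        have p8 := hρ t ht x hx
        have p9 : (γ (w t x) - softPos' (w t x / κ - 1) * w t x) * traceEnd (fderiv ℝ (a t) x)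
            ≤ 3 * κ * (d * |ρ|) := by
          refine (le_abs_self _).trans ?_
          rw [abs_mul]
          have : (d : ℝ) * ρ ≤ d * |ρ| := by gcongr; exact le_abs_self ρ
          exact mul_le_mul p7 (p8.trans this) (abs_nonneg _) (by positivity)
        have p10 : 0 ≤ ν * (softPos'' (w t x / κ - 1) * (1 / κ) *
            ∑ j : Fin d, (dx1 (w t) x (ebasis d j)) ^ 2) := by
          have := softPos''_nonneg (w t x / κ - 1)
          have : 0 ≤ ∑ j : Fin d, (dx1 (w t) x (ebasis d j)) ^ 2 :=
            Finset.sum_nonneg fun j _ => sq_nonneg _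
          positivity
        simp only [smul_apply, smul_eq_mul]
        set g' := softPos' (w t x / κ - 1)
        have e1 : g' * dtt w t x - ν * (g' * trace2 (dx2 (w t) x) +
            softPos'' (w t x / κ - 1) * (1 / κ) * ∑ j : Fin d, (dx1 (w t) x (ebasis d j)) ^ 2)
            + g' * dx1 (w t) x (a t x) + γ (w t x) * traceEnd (fderiv ℝ (a t) x)
            ≤ 3 * κ * (d * |ρ|) := by
          have : g' * (dtt w t x - ν * trace2 (dx2 (w t) x) + dx1 (w t) x (a t x)
            + w t x * traceEnd (fderiv ℝ (a t) x)) = 0 := by rw [p1, mul_zero]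
          linarith
        have e2 := mul_le_mul_of_nonneg_left e1 p4
        have e3 : φ t x * (3 * κ * (d * |ρ|)) ≤ 3 * κ * (d * |ρ|) * C := by
          rw [mul_comm]; gcongr
        have e4 := mul_nonneg p6 (neg_nonneg.2 p2)
        linarith)
    have s2 : ∫ x in D, w t₂ x * φ t₂ x ≤
        (∫ x in D, γ (w t₂ x) * φ t₂ x) + 3 * κ * C * volume.real D := by
      have i1 : IntegrableOn (fun x => γ (w t₂ x) * φ t₂ x) D :=
        hcint ((hu.continuousOn_slice m2).mul (hφ.continuousOn_slice m2))
      have : 3 * κ * C * volume.real D = ∫ _ in D, 3 * κ * C := by simp [mul_comm]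
      rw [this, ← integral_add i1 (integrableOn_const hfin)]
      refine setIntegral_mono_on
        (hcint ((h.data.continuousOn_slice (hI m2)).mul (hφ.continuousOn_slice m2)))
        (i1.add (integrableOn_const hfin)) hD.measurableSet fun x hx => ?_
      have p4 := hφ0 t₂ m2 x hx
      have p5 := (le_abs_self _).trans (hC t₂ m2 x (subset_closure hx))
      nlinarith [hγ2 (w t₂ x), mul_le_mul_of_nonneg_left p5 hκ.le]
    have s1 : ∫ x in D, γ (w t₁ x) * φ t₁ x ≤ ∫ x in D, w t₁ x * φ t₁ x := by
      refine setIntegral_mono_on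
        (hcint ((hu.continuousOn_slice m1).mul (hφ.continuousOn_slice m1)))
        (hcint ((h.data.continuousOn_slice (hI m1)).mul (hφ.continuousOn_slice m1)))
        hD.measurableSet fun x hx => ?_
      exact mul_le_mul_of_nonneg_right
        (hγ1 _ (h.nonneg t₁ (hI m1) x (subset_closure hx))) (hφ0 t₁ m1 x hx)
    have : B * κ = 3 * κ * (d * |ρ|) * C * volume.real D * (t₂ - t₁)
        + 3 * κ * C * volume.real D := by rw [hB]; ring
    linarith
  refine le_of_forall_pos_le_add fun ε hε => ?_
  have h1 := key (ε / (B + 1)) (by positivity)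
  have h2 : B * (ε / (B + 1)) ≤ ε := by
    rw [mul_div_assoc', div_le_iff₀ (by positivity)]
    nlinarith
  linarith

end IsSol

/-- Exponential loss (for `σ = 1`) or gain (for `σ = -1`) of the Gaussian barriers. -/
def barrierK (d : ℕ) (ν A σ s : ℝ) : ℝ := 2 * σ * (2 * d * ν + 1) * A * √s + 4 * ν * A ^ 2 * s

/-- Inverse width of the Gaussian barriers. -/
def barrierG (ν A σ s : ℝ) : ℝ := 1 / (4 * ν * s) + σ * A / √s

/-- Logarithm of the Gaussian barriers, as a function of time and squared distance. -/
def logBarrier (d : ℕ) (ν A σ s r2 : ℝ) : ℝ :=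
  -(d / 2) * Real.log s - barrierK d ν A σ s - barrierG ν A σ s * r2

lemma hasDerivAt_barrierK (d : ℕ) (ν A σ : ℝ) {s : ℝ} (hs : 0 < s) :
    HasDerivAt (barrierK d ν A σ) (σ * (2 * d * ν + 1) * A / √s + 4 * ν * A ^ 2) s := by
  have h1 := (Real.hasDerivAt_sqrt hs.ne').const_mul (2 * σ * (2 * d * ν + 1) * A)
  have h2 := (hasDerivAt_id s).const_mul (4 * ν * A ^ 2)
  refine (h1.add h2).congr_deriv ?_
  have := Real.sqrt_pos.2 hs
  field_simp

lemma hasDerivAt_barrierG {ν : ℝ} (hν : 0 < ν) (A σ : ℝ) {s : ℝ} (hs : 0 < s) :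
    HasDerivAt (barrierG ν A σ) (-(1 / (4 * ν * s ^ 2)) - σ * A / (2 * s * √s)) s := by
  have hq := Real.sqrt_pos.2 hs
  have h1 := (((hasDerivAt_id s).const_mul (4 * ν)).inv (by simp only [id]; positivity))
  have h2 := ((Real.hasDerivAt_sqrt hs.ne').inv hq.ne').const_mul (σ * A)
  have h3 := h1.add h2
  have h4 : barrierG ν A σ = (fun s => 4 * ν * id s)⁻¹ + fun s => σ * A * (Real.sqrt)⁻¹ s := by
    ext s
    simp [barrierG, div_eq_mul_inv]
  rw [h4]
  refine h3.congr_deriv ?_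
  have e : s = √s ^ 2 := (Real.sq_sqrt hs.le).symm
  simp only [id]
  rw [Real.sq_sqrt hs.le]
  field_simp
  ring

/-- The differential inequality behind the Gaussian barriers. -/
lemma barrier_inequality (d : ℕ) {ν A σ s r : ℝ} (hν : 0 < ν) (hA : 0 ≤ A) (hs : 0 < s)
    (hσ : σ ^ 2 = 1) (hG : 0 ≤ barrierG ν A σ s) :
    4 * ν * A * (2 * barrierG ν A σ s * r) ≤
      σ * ((d / 2) / s + (σ * (2 * d * ν + 1) * A / √s + 4 * ν * A ^ 2)
        + (-(1 / (4 * ν * s ^ 2)) - σ * A / (2 * s * √s)) * r ^ 2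
        + ν * (-2 * barrierG ν A σ s * d + 4 * barrierG ν A σ s ^ 2 * r ^ 2)) := by
  set v := √s with hv
  have hv0 : 0 < v := Real.sqrt_pos.2 hs
  have hsv : s = v ^ 2 := (Real.sq_sqrt hs.le).symm
  set g := barrierG ν A σ s with hg
  have hg' : g = 1 / (4 * ν * v ^ 2) + σ * A / v := by rw [hg, barrierG, ← hv, hsv]
  have key : σ * ((d / 2) / s + (σ * (2 * d * ν + 1) * A / v + 4 * ν * A ^ 2)
        + (-(1 / (4 * ν * s ^ 2)) - σ * A / (2 * s * v)) * r ^ 2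
        + ν * (-2 * g * d + 4 * g ^ 2 * r ^ 2)) - 4 * ν * A * (2 * g * r)
      = 4 * ν * A * g * ((v - r) ^ 2 / v) + A * r ^ 2 / (2 * v ^ 3) := by
    have hσ' : σ = 1 ∨ σ = -1 := sq_eq_one_iff.1 hσ
    rw [hg', hsv]
    rcases hσ' with h | h <;> rw [h] <;> field_simp <;> ring
  have : 0 ≤ 4 * ν * A * g * ((v - r) ^ 2 / v) + A * r ^ 2 / (2 * v ^ 3) := by positivity
  linarith

lemma C12Data.radial {d : ℕ} {J : Set ℝ} (D : Set (Euc d)) (x₀ : Euc d) {p p' q q' : ℝ → ℝ}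
    (hp : ∀ t ∈ J, HasDerivAt p (p' t) t) (hp' : ContinuousOn p' J)
    (hq : ∀ t ∈ J, HasDerivAt q (q' t) t) (hq' : ContinuousOn q' J) :
    C12Data J D (fun t x => p t + q t * ‖x - x₀‖ ^ 2) (fun t x => p' t + q' t * ‖x - x₀‖ ^ 2)
      (fun t x => (2 * q t) • innerSL ℝ (x - x₀))
      (fun t _ => (2 * q t) • (innerSL ℝ : Euc d →L[ℝ] Euc d →L[ℝ] ℝ)) where
  hasDerivAt t ht x _ := (hp t ht).add ((hq t ht).mul_const _)
  hasFDerivAt t _ x _ := by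
    have h1 : HasFDerivAt (fun x => x - x₀) (ContinuousLinearMap.id ℝ (Euc d)) x :=
      (hasFDerivAt_id x).sub_const x₀
    refine ((h1.norm_sq.const_mul (q t)).const_add (p t)).congr_fderiv ?_
    ext v
    simp
    ring
  hasFDerivAt₂ t _ x _ := by
    have h1 : HasFDerivAt (fun x => x - x₀) (ContinuousLinearMap.id ℝ (Euc d)) x :=
      (hasFDerivAt_id x).sub_const x₀
    have h2 := ((innerSL ℝ : Euc d →L[ℝ] Euc d →L[ℝ] ℝ).hasFDerivAt.comp x h1).const_smul (2 * q t)
    exact h2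
  cont := by
    have c1 : ContinuousOn p J := fun t ht => (hp t ht).continuousAt.continuousWithinAt
    have c2 : ContinuousOn q J := fun t ht => (hq t ht).continuousAt.continuousWithinAt
    have f1 : MapsTo (fun x : ℝ × Euc d => x.1) (J ×ˢ closure D) J := fun x hx => hx.1
    exact (c1.comp continuousOn_fst f1).add
      ((c2.comp continuousOn_fst f1).mul (by fun_prop))
  cont_t := by
    have f1 : MapsTo (fun x : ℝ × Euc d => x.1) (J ×ˢ closure D) J := fun x hx => hx.1
    exact (hp'.comp continuousOn_fst f1).add
      ((hq'.comp continuousOn_fst f1).mul (by fun_prop))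
  cont₁ := by
    have c2 : ContinuousOn q J := fun t ht => (hq t ht).continuousAt.continuousWithinAt
    have f1 : MapsTo (fun x : ℝ × Euc d => x.1) (J ×ˢ closure D) J := fun x hx => hx.1
    exact (continuousOn_const.mul (c2.comp continuousOn_fst f1)).smul (by fun_prop)
  cont₂ := by
    have c2 : ContinuousOn q J := fun t ht => (hq t ht).continuousAt.continuousWithinAt
    have f1 : MapsTo (fun x : ℝ × Euc d => x.1) (J ×ˢ closure D) J := fun x hx => hx.1
    exact (continuousOn_const.mul (c2.comp continuousOn_fst f1)).smul continuousOn_const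

lemma trace2_smul_innerSL {d : ℕ} (c : ℝ) :
    trace2 (c • (innerSL ℝ : Euc d →L[ℝ] Euc d →L[ℝ] ℝ)) = c * d := by
  have h : ∀ j : Fin d, (c • (innerSL ℝ : Euc d →L[ℝ] Euc d →L[ℝ] ℝ)) (ebasis d j) (ebasis d j)
      = c := fun j => by
    change c * inner ℝ (ebasis d j) (ebasis d j) = c
    rw [real_inner_self_eq_norm_sq, norm_ebasis]
    ring
  simp only [trace2, h]
  simp [mul_comm]

lemma sum_sq_smul_innerSL {d : ℕ} (c : ℝ) (x : Euc d) :
    ∑ j : Fin d, ((c • innerSL ℝ x) (ebasis d j)) ^ 2 = c ^ 2 * ‖x‖ ^ 2 := by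
  rw [EuclideanSpace.real_norm_sq_eq, Finset.mul_sum]
  refine Finset.sum_congr rfl fun j _ => ?_
  simp [ebasis, mul_pow, EuclideanSpace.inner_single_right]

/-- The logarithm of a Gaussian barrier, run backwards in time from `t₂`, has the regularity
and satisfies the differential inequality needed for a sub- or supersolution. -/
lemma exists_logBarrier_data {d : ℕ} (D : Set (Euc d)) (x₀ : Euc d) {ν A σ t₁ t₁' t₂ : ℝ}
    (hν : 0 < ν) (hA : 0 ≤ A) (hσ : σ ^ 2 = 1) (h12 : t₁' < t₂) :
    ∃ Ψt Ψ1 Ψ2, C12Data (Icc t₁ t₁') D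
      (fun t x => logBarrier d ν A σ (t₂ - t) (‖x - x₀‖ ^ 2)) Ψt Ψ1 Ψ2 ∧
      ∀ t ∈ Icc t₁ t₁', 0 ≤ barrierG ν A σ (t₂ - t) → ∀ x v, ‖v‖ ≤ 4 * ν * A →
        0 ≤ σ * (Ψt t x + ν * (trace2 (Ψ2 t x) + ∑ j : Fin d, (Ψ1 t x (ebasis d j)) ^ 2)
          + Ψ1 t x v) := by
  have hpos : ∀ t ∈ Icc t₁ t₁', 0 < t₂ - t := fun t ht => by linarith [ht.2]
  have hsub : ∀ t : ℝ, HasDerivAt (fun t => t₂ - t) (-1) t := fun t =>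
    (hasDerivAt_id t).const_sub t₂
  have hp : ∀ t ∈ Icc t₁ t₁', HasDerivAt
      (fun t => -(d / 2) * Real.log (t₂ - t) - barrierK d ν A σ (t₂ - t))
      ((d / 2) / (t₂ - t) + (σ * (2 * d * ν + 1) * A / √(t₂ - t) + 4 * ν * A ^ 2)) t := by
    intro t ht
    have h1 := ((hsub t).log (hpos t ht).ne').const_mul (-((d : ℝ) / 2))
    have h2 := (hasDerivAt_barrierK d ν A σ (hpos t ht)).comp t (hsub t)
    refine (h1.sub h2).congr_deriv ?_
    have := hpos t ht
    field_simp
    ring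
  have hq : ∀ t ∈ Icc t₁ t₁', HasDerivAt (fun t => -barrierG ν A σ (t₂ - t))
      (-(1 / (4 * ν * (t₂ - t) ^ 2)) - σ * A / (2 * (t₂ - t) * √(t₂ - t))) t := by
    intro t ht
    have h2 := ((hasDerivAt_barrierG hν A σ (hpos t ht)).comp t (hsub t)).neg
    refine h2.congr_deriv ?_
    ring
  have hp' : ContinuousOn (fun t => (d / 2) / (t₂ - t) +
      (σ * (2 * d * ν + 1) * A / √(t₂ - t) + 4 * ν * A ^ 2)) (Icc t₁ t₁') := by
    refine ContinuousOn.add (ContinuousOn.div (by fun_prop) (by fun_prop)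
      fun t ht => (hpos t ht).ne') (ContinuousOn.add (ContinuousOn.div (by fun_prop)
      (by fun_prop) fun t ht => (Real.sqrt_pos.2 (hpos t ht)).ne') (by fun_prop))
  have hq' : ContinuousOn (fun t => -(1 / (4 * ν * (t₂ - t) ^ 2)) -
      σ * A / (2 * (t₂ - t) * √(t₂ - t))) (Icc t₁ t₁') := by
    refine ContinuousOn.sub (ContinuousOn.neg (ContinuousOn.div (by fun_prop) (by fun_prop)
      fun t ht => ?_)) (ContinuousOn.div (by fun_prop)
      (by fun_prop) fun t ht => ?_)
    · have := hpos t ht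
      positivity
    · have := hpos t ht
      have := Real.sqrt_pos.2 this
      positivity
  have hdata := C12Data.radial D x₀ hp hp' hq hq'
  have he : (fun (t : ℝ) (x : Euc d) => logBarrier d ν A σ (t₂ - t) (‖x - x₀‖ ^ 2)) = fun t x =>
      -(d / 2) * Real.log (t₂ - t) - barrierK d ν A σ (t₂ - t)
        + -barrierG ν A σ (t₂ - t) * ‖x - x₀‖ ^ 2 := by
    funext t x
    simp only [logBarrier]
    ring
  rw [← he] at hdata
  refine ⟨_, _, _, hdata, ?_⟩
  intro t ht hG x v hv
  have hb := barrier_inequality d (r := ‖x - x₀‖) hν hA (hpos t ht) hσ hG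
  rw [trace2_smul_innerSL, sum_sq_smul_innerSL]
  have h1 : |σ| = 1 := by
    rcases sq_eq_one_iff.1 hσ with h | h <;> simp [h]
  have h2 : |inner ℝ (x - x₀) v| ≤ ‖x - x₀‖ * (4 * ν * A) :=
    (abs_real_inner_le_norm _ _).trans (by gcongr)
  have h3 : |σ * (2 * barrierG ν A σ (t₂ - t) * inner ℝ (x - x₀) v)|
      ≤ 2 * barrierG ν A σ (t₂ - t) * (‖x - x₀‖ * (4 * ν * A)) := by
    rw [abs_mul, h1, one_mul, abs_mul, abs_of_nonneg (by positivity)]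
    gcongr
  have h4 := (le_abs_self _).trans h3
  have h5 : ((2 * -barrierG ν A σ (t₂ - t)) • innerSL ℝ (x - x₀)) v
      = -(2 * barrierG ν A σ (t₂ - t) * inner ℝ (x - x₀) v) := by
    change 2 * -barrierG ν A σ (t₂ - t) * inner ℝ (x - x₀) v = _
    ring
  rw [h5]
  linarith

lemma barrierG_neg_one_nonneg {ν ρ s : ℝ} (hν : 0 < ν) (hs : 0 < s) (h : ρ * √s ≤ 1) :
    0 ≤ barrierG ν (ρ / (4 * ν)) (-1) s := by
  have h2 := Real.sqrt_pos.2 hs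
  have h3 : barrierG ν (ρ / (4 * ν)) (-1) s = (1 - ρ * √s) / (4 * ν * s) := by
    have e : s = √s ^ 2 := (Real.sq_sqrt hs.le).symm
    rw [barrierG]
    generalize √s = v at *
    rw [e]
    field_simp
    ring
  rw [h3]
  exact div_nonneg (by linarith) (by positivity)

lemma exists_upper_barrier {d : ℕ} (D : Set (Euc d)) (x₀ : Euc d) {ν ρ t₁ t₁' t₂ : ℝ}
    (hν : 0 < ν) (hρ : 0 ≤ ρ) (h12 : t₁' < t₂) (hs : ρ * √(t₂ - t₁) ≤ 1) :
    ∃ φt φ1 φ2, C12Data (Icc t₁ t₁') D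
      (fun t x => Real.exp (logBarrier d ν (ρ / (4 * ν)) (-1) (t₂ - t) (‖x - x₀‖ ^ 2))) φt φ1 φ2 ∧
      ∀ t ∈ Icc t₁ t₁', ∀ x v, ‖v‖ ≤ ρ → φt t x + ν * trace2 (φ2 t x) + φ1 t x v ≤ 0 := by
  obtain ⟨Ψt, Ψ1, Ψ2, hΨ, hineq⟩ := exists_logBarrier_data (d := d) (t₁ := t₁) (A := ρ / (4 * ν))
    (σ := -1) D x₀ hν (by positivity) (by norm_num) h12
  refine ⟨_, _, _, hΨ.comp (γ := Real.exp) Real.hasDerivAt_exp Real.hasDerivAt_exp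
    Real.continuous_exp, ?_⟩
  intro t ht x v hv
  have hpos : 0 < t₂ - t := by linarith [ht.2]
  have hG : 0 ≤ barrierG ν (ρ / (4 * ν)) (-1) (t₂ - t) := by
    have h1 : ρ * √(t₂ - t) ≤ 1 := by
      refine le_trans ?_ hs
      gcongr
      exact ht.1
    exact barrierG_neg_one_nonneg hν hpos h1
  have h := hineq t ht hG x v (by rwa [mul_div_cancel₀ _ (by positivity)])
  rw [trace2_comp]
  simp only [smul_apply, smul_eq_mul]
  nlinarith [Real.exp_pos (logBarrier d ν (ρ / (4 * ν)) (-1) (t₂ - t) (‖x - x₀‖ ^ 2))]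

lemma exists_lower_barrier {d : ℕ} (D : Set (Euc d)) (x₀ : Euc d) {ν ρ t₁ t₁' t₂ : ℝ} (m : ℝ)
    (hν : 0 < ν) (hρ : 0 ≤ ρ) (h12 : t₁' < t₂) :
    ∃ φt φ1 φ2, C12Data (Icc t₁ t₁') D
      (fun t x => softPos
        (Real.exp (logBarrier d ν (ρ / (4 * ν)) 1 (t₂ - t) (‖x - x₀‖ ^ 2)) - m)) φt φ1 φ2 ∧
      ∀ t ∈ Icc t₁ t₁', ∀ x v, ‖v‖ ≤ ρ → 0 ≤ φt t x + ν * trace2 (φ2 t x) + φ1 t x v := by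
  obtain ⟨Ψt, Ψ1, Ψ2, hΨ, hineq⟩ := exists_logBarrier_data (d := d) (t₁ := t₁) (A := ρ / (4 * ν))
    (σ := 1) D x₀ hν (by positivity) (by norm_num) h12
  have he : ∀ z, HasDerivAt (fun z => Real.exp z - m) (Real.exp z) z := fun z =>
    (Real.hasDerivAt_exp z).sub_const m
  refine ⟨_, _, _, hΨ.comp (γ := fun z => softPos (Real.exp z - m))
    (γ' := fun z => softPos' (Real.exp z - m) * Real.exp z)
    (γ'' := fun z => softPos'' (Real.exp z - m) * Real.exp z * Real.exp z
      + softPos' (Real.exp z - m) * Real.exp z)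
    (fun z => HasDerivAt.comp (h₂ := softPos) z (hasDerivAt_softPos _) (he z))
    (fun z => (HasDerivAt.comp (h₂ := softPos') z (hasDerivAt_softPos' _) (he z)).mul
      (Real.hasDerivAt_exp z)) ?_, ?_⟩
  · have c1 : Continuous softPos' :=
      continuous_iff_continuousAt.2 fun z => (hasDerivAt_softPos' z).continuousAt
    have c2 := continuous_softPos''
    have c3 : Continuous fun z => Real.exp z - m := by fun_prop
    exact (((c2.comp c3).mul Real.continuous_exp).mul Real.continuous_exp).add
      ((c1.comp c3).mul Real.continuous_exp)
  intro t ht x v hv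
  have hpos : 0 < t₂ - t := by linarith [ht.2]
  have hG : 0 ≤ barrierG ν (ρ / (4 * ν)) 1 (t₂ - t) := by
    rw [barrierG]
    positivity
  have h := hineq t ht hG x v (by rwa [mul_div_cancel₀ _ (by positivity)])
  rw [trace2_comp]
  simp only [smul_apply, smul_eq_mul]
  set z := logBarrier d ν (ρ / (4 * ν)) 1 (t₂ - t) (‖x - x₀‖ ^ 2)
  have h1 : 0 ≤ softPos' (Real.exp z - m) * Real.exp z :=
    mul_nonneg (softPos'_nonneg _) (Real.exp_pos z).le
  have h2 : 0 ≤ softPos'' (Real.exp z - m) * Real.exp z * Real.exp z :=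
    mul_nonneg (mul_nonneg (softPos''_nonneg _) (Real.exp_pos z).le) (Real.exp_pos z).le
  have h3 : 0 ≤ ∑ j : Fin d, (Ψ1 t x (ebasis d j)) ^ 2 := Finset.sum_nonneg fun j _ => sq_nonneg _
  have h4 := mul_nonneg h1 h
  have h5 := mul_nonneg hν.le (mul_nonneg h2 h3)
  linarith

namespace IsSol

variable {d : ℕ} {D : Set (Euc d)} {ν T ρ : ℝ} {a : ℝ → Euc d → Euc d} {w : ℝ → Euc d → ℝ}
  {t₁ t₂ : ℝ}

lemma norm_a_le (h : IsSol D ν T ρ a w) {t : ℝ} (ht : t ∈ Icc 0 T) {x : Euc d} (hx : x ∈ D) :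
    ‖a t x‖ ≤ ρ := by
  have := h.a_le t ht x hx
  linarith [norm_nonneg (fderiv ℝ (a t) x)]

lemma integral_antitone (h : IsSol D ν T ρ a w) (hν : 0 < ν) (hD : IsOpen D)
    (hb : Bornology.IsBounded D) (h0 : 0 ≤ t₁) (h12 : t₁ ≤ t₂) (hT : t₂ ≤ T) :
    ∫ x in D, w t₂ x ≤ ∫ x in D, w t₁ x := by
  have := h.integral_mul_le_of_supersolution hν hD hb h0 h12 hT (C12Data.const _ D 1)
    (fun _ _ _ _ => zero_le_one) (fun t ht x hx => by simp [trace2])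
  simpa using this

end IsSol

namespace IsSol

variable {d : ℕ} {D : Set (Euc d)} {ν T ρ : ℝ} {a : ℝ → Euc d → Euc d} {w : ℝ → Euc d → ℝ}

lemma exists_ball_abs_sub_lt (h : IsSol D ν T ρ a w) (hD : IsOpen D) {t : ℝ} (ht : t ∈ Icc 0 T)
    {x₀ : Euc d} (hx₀ : x₀ ∈ D) {η : ℝ} (hη : 0 < η) :
    ∃ δ > 0, Metric.ball x₀ δ ⊆ D ∧ ∀ t' ∈ Icc (0:ℝ) T, |t' - t| < δ →
      ∀ x ∈ Metric.ball x₀ δ, |w t' x - w t x₀| < η := by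
  obtain ⟨r, hr, hrD⟩ := Metric.isOpen_iff.1 hD x₀ hx₀
  obtain ⟨δ, hδ, hw⟩ := Metric.continuousOn_iff.1 h.data.cont (t, x₀) ⟨ht, subset_closure hx₀⟩ η hη
  refine ⟨min δ r, lt_min hδ hr, (Metric.ball_subset_ball (min_le_right _ _)).trans hrD, ?_⟩
  intro t' ht' htt x hx
  have hxD : x ∈ D := hrD (Metric.ball_subset_ball (min_le_right _ _) hx)
  refine hw (t', x) ⟨ht', subset_closure hxD⟩ ?_
  rw [Prod.dist_eq]
  exact max_lt (htt.trans_le (min_le_left _ _)) (hx.trans_le (min_le_left _ _))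

end IsSol

lemma exists_pointwise_le_integral (d : ℕ) {ν ρ τ : ℝ} (hν : 0 < ν) (hρ : 0 ≤ ρ) (hτ : 0 < τ)
    (hs : ρ * √τ ≤ 1) :
    ∃ C > 0, ∀ (D : Set (Euc d)) (T : ℝ) (a : ℝ → Euc d → Euc d) (w : ℝ → Euc d → ℝ), IsOpen D →
      Bornology.IsBounded D → IsSol D ν T ρ a w → ∀ t, τ ≤ t → t ≤ T → ∀ x ∈ D,
        w t x ≤ C * ∫ y in D, w (t - τ) y := by
  set A := ρ / (4 * ν) with hA
  have hA0 : 0 ≤ A := by positivity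
  set V := volume.real (Metric.ball (0 : Euc d) 1) with hV
  have hV0 : 0 < V := ENNReal.toReal_pos (Metric.measure_ball_pos _ _ one_pos).ne'
    measure_ball_lt_top.ne
  set c₁ := Real.exp (-(4 * ν * A ^ 2 * τ) - 1 / (4 * ν)) with hc₁
  set c₂ := Real.exp (-(d / 2) * Real.log τ - barrierK d ν A (-1) τ) with hc₂
  have hc₁0 : 0 < c₁ := Real.exp_pos _
  have hc₂0 : 0 < c₂ := Real.exp_pos _
  refine ⟨c₂ / (c₁ * V), by positivity, ?_⟩
  intro D T a w hD hb h t hτt htT x₀ hx₀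
  refine le_of_forall_pos_le_add fun η hη => ?_
  have ht : t ∈ Icc 0 T := ⟨by linarith, htT⟩
  obtain ⟨δ, hδ, hδD, hδw⟩ := h.exists_ball_abs_sub_lt hD ht hx₀ hη
  have hev : ∀ᶠ s in 𝓝[>] (0:ℝ), s < τ ∧ s < δ ∧ √s < δ := by
    have h1 : ∀ᶠ s in 𝓝 (0:ℝ), s < τ ∧ s < δ ∧ √s < δ :=
      (eventually_lt_nhds hτ).and ((eventually_lt_nhds hδ).and
        (Real.continuous_sqrt.continuousAt.eventually_lt_const (by simpa using hδ)))
    exact h1.filter_mono nhdsWithin_le_nhds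
  obtain ⟨s, ⟨hsτ, hsδ, hsδ'⟩, hs0⟩ := (hev.and self_mem_nhdsWithin).exists
  have hs0 : 0 < s := hs0
  have hq0 := Real.sqrt_pos.2 hs0
  obtain ⟨φt, φ1, φ2, hφ, hsup⟩ := exists_upper_barrier D x₀ (t₁ := t - τ) (t₁' := t - s)
    (t₂ := t) hν hρ (by linarith) (by simpa using hs)
  have hle := h.integral_mul_le_of_supersolution hν hD hb (by linarith) (by linarith)
    (by linarith) hφ (fun _ _ _ _ => (Real.exp_pos _).le)
    (fun t' ht' x hx => hsup t' ht' x _ (h.norm_a_le ⟨by linarith [ht'.1], by linarith [ht'.2]⟩ hx))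
  have m1 : t - τ ∈ Icc 0 T := ⟨by linarith, by linarith⟩
  have m2 : t - s ∈ Icc 0 T := ⟨by linarith, by linarith⟩
  have hcint : ∀ {h : Euc d → ℝ}, ContinuousOn h (closure D) → IntegrableOn h D := fun hh =>
    (hh.integrableOn_compact hb.isCompact_closure).mono_set subset_closure
  have hright : ∫ x in D, w (t - τ) x * Real.exp (logBarrier d ν A (-1) (t - (t - τ))
      (‖x - x₀‖ ^ 2)) ≤ c₂ * ∫ y in D, w (t - τ) y := by
    rw [← integral_const_mul]
    refine setIntegral_mono_on (hcint ((h.data.continuousOn_slice m1).mul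
      (hφ.continuousOn_slice ⟨le_rfl, by linarith⟩)))
      ((h.data.integrableOn hb m1).const_mul _) hD.measurableSet fun x hx => ?_
    rw [mul_comm]
    refine mul_le_mul_of_nonneg_right ?_ (h.nonneg _ m1 x (subset_closure hx))
    rw [hc₂, sub_sub_cancel]
    refine Real.exp_le_exp.2 ?_
    have hG : 0 ≤ barrierG ν A (-1) τ := barrierG_neg_one_nonneg hν hτ hs
    have : 0 ≤ barrierG ν A (-1) τ * ‖x - x₀‖ ^ 2 := by positivity
    rw [logBarrier]
    linarith
  have hleft : (w t x₀ - η) * (c₁ * V) ≤ ∫ x in D, w (t - s) x *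
      Real.exp (logBarrier d ν A (-1) (t - (t - s)) (‖x - x₀‖ ^ 2)) := by
    have hsub : Metric.ball x₀ (√s) ⊆ D := (Metric.ball_subset_ball hsδ'.le).trans hδD
    have hi := hcint ((h.data.continuousOn_slice m2).mul
      (hφ.continuousOn_slice ⟨by linarith, le_rfl⟩))
    have h1 : ∫ x in Metric.ball x₀ (√s), w (t - s) x *
        Real.exp (logBarrier d ν A (-1) (t - (t - s)) (‖x - x₀‖ ^ 2)) ≤ ∫ x in D, w (t - s) x *
        Real.exp (logBarrier d ν A (-1) (t - (t - s)) (‖x - x₀‖ ^ 2)) := by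
      refine setIntegral_mono_set hi ?_ hsub.eventuallyLE
      filter_upwards [ae_restrict_mem hD.measurableSet] with x hx
      exact mul_nonneg (h.nonneg _ m2 x (subset_closure hx)) (Real.exp_pos _).le
    refine le_trans ?_ h1
    rcases le_or_gt (w t x₀ - η) 0 with hneg | hpos
    · refine (mul_nonpos_of_nonpos_of_nonneg hneg (by positivity)).trans ?_
      refine setIntegral_nonneg measurableSet_ball fun x hx => ?_
      exact mul_nonneg (h.nonneg _ m2 x (subset_closure (hsub hx))) (Real.exp_pos _).le
    set e := Real.exp (-(d / 2) * Real.log s) with he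
    have hvol : volume.real (Metric.ball x₀ (√s)) * e = V := by
      have h2 : volume.real (Metric.ball x₀ (√s)) = √s ^ d * V := by
        rw [Measure.real, Measure.addHaar_ball_of_pos _ _ hq0, ENNReal.toReal_mul,
          ENNReal.toReal_ofReal (by positivity), finrank_euclideanSpace_fin]
        rfl
      have h3 : √s ^ d * e = 1 := by
        have : √s = Real.exp (Real.log s / 2) := by
          rw [← Real.log_sqrt hs0.le, Real.exp_log hq0]
        rw [this, he, ← Real.exp_nat_mul, ← Real.exp_add, Real.exp_eq_one_iff]
        ring
      rw [h2, mul_right_comm, h3, one_mul]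
    have h4 : (w t x₀ - η) * (c₁ * V)
        = ∫ x in Metric.ball x₀ (√s), (w t x₀ - η) * (e * c₁) := by
      rw [setIntegral_const, smul_eq_mul, ← hvol]
      ring
    rw [h4]
    refine setIntegral_mono_on (integrableOn_const measure_ball_lt_top.ne) (hi.mono_set hsub)
      measurableSet_ball fun x hx => ?_
    have h5 := hδw (t - s) m2 (by rw [abs_lt]; constructor <;> linarith) x
      (Metric.ball_subset_ball hsδ'.le hx)
    have h6 := (abs_lt.1 h5).1
    refine mul_le_mul (by linarith) ?_ (by positivity) (h.nonneg _ m2 x (subset_closure (hsub hx)))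
    rw [he, hc₁, ← Real.exp_add, sub_sub_cancel]
    refine Real.exp_le_exp.2 ?_
    have h7 : ‖x - x₀‖ ^ 2 ≤ s := by
      rw [Metric.mem_ball, dist_eq_norm] at hx
      calc ‖x - x₀‖ ^ 2 ≤ √s ^ 2 := by gcongr
        _ = s := Real.sq_sqrt hs0.le
    have h8 : barrierG ν A (-1) s * ‖x - x₀‖ ^ 2 ≤ 1 / (4 * ν) := by
      calc barrierG ν A (-1) s * ‖x - x₀‖ ^ 2 ≤ 1 / (4 * ν * s) * ‖x - x₀‖ ^ 2 := by
            gcongr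
            rw [barrierG]
            have : 0 ≤ A / √s := by positivity
            have : -1 * A / √s = -(A / √s) := by ring
            linarith
        _ ≤ 1 / (4 * ν * s) * s := by gcongr
        _ = 1 / (4 * ν) := by field_simp
    have h9 : barrierK d ν A (-1) s ≤ 4 * ν * A ^ 2 * τ := by
      rw [barrierK]
      have h10 : 0 ≤ 2 * (2 * d * ν + 1) * A * √s := by positivity
      have h11 : 4 * ν * A ^ 2 * s ≤ 4 * ν * A ^ 2 * τ := by gcongr
      linarith
    rw [logBarrier]
    linarith
  have hfin := (hleft.trans hle).trans hright
  rw [← sub_le_iff_le_add, div_mul_eq_mul_div, le_div_iff₀ (by positivity)]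
  exact hfin

lemma neg_mul_log_sub_div_le {k b s θ : ℝ} (hs : 0 < s) (hsθ : s ≤ θ) (hk : 0 ≤ k)
    (hb : k * θ ≤ b) : -k * Real.log s - b / s ≤ -k * Real.log θ - b / θ := by
  have hθ : 0 < θ := hs.trans_le hsθ
  have h1 := Real.log_le_sub_one_of_pos (div_pos hθ hs)
  rw [Real.log_div hθ.ne' hs.ne'] at h1
  have h2 : k * (Real.log θ - Real.log s) ≤ k * (θ / s - 1) := by gcongr
  have h3 : 0 ≤ (b - k * θ) * ((θ - s) / (s * θ)) :=
    mul_nonneg (by linarith) (div_nonneg (by linarith) (by positivity))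
  have h4 : (b - k * θ) * ((θ - s) / (s * θ)) = b / s - b / θ - k * (θ / s - 1) := by
    field_simp
  linarith

lemma logBarrier_one_le {d : ℕ} {ν A s r2 : ℝ} (hν : 0 < ν) (hA : 0 ≤ A) (hs : 0 < s)
    (hr : 0 ≤ r2) :
    logBarrier d ν A 1 s r2 ≤ -(d / 2) * Real.log s - r2 / (4 * ν) / s := by
  have h1 : 0 ≤ barrierK d ν A 1 s := by rw [barrierK]; positivity
  have h2 : r2 / (4 * ν) / s ≤ barrierG ν A 1 s * r2 := by
    have : barrierG ν A 1 s * r2 = r2 / (4 * ν) / s + A / √s * r2 := by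
      rw [barrierG]
      field_simp
    rw [this]
    have : 0 ≤ A / √s * r2 := by positivity
    linarith
  rw [logBarrier]
  linarith

lemma tendsto_exp_neg_mul_log_sub_div (k : ℝ) {b : ℝ} (hb : 0 < b) :
    Tendsto (fun s => Real.exp (-k * Real.log s - b / s)) (𝓝[>] 0) (𝓝 0) := by
  refine Real.tendsto_exp_atBot.comp ?_
  have h1 : Tendsto (fun s => Real.log s * s) (𝓝[>] 0) (𝓝 0) := by
    simpa using tendsto_log_mul_rpow_nhdsGT_zero one_pos
  have h2 : Tendsto (fun s => -k * (Real.log s * s) - b) (𝓝[>] 0) (𝓝 (-b)) := by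
    simpa using (h1.const_mul (-k)).sub_const b
  refine (h2.neg_mul_atTop (neg_neg_of_pos hb) tendsto_inv_nhdsGT_zero).congr' ?_
  filter_upwards [self_mem_nhdsWithin] with s hs
  have : s ≠ 0 := (mem_Ioi.1 hs).ne'
  field_simp

lemma eventually_barrier_gap (d : ℕ) {ν R : ℝ} (A : ℝ) (hν : 0 < ν) (hR : 0 < R) :
    ∀ᶠ θ in 𝓝[>] (0:ℝ), (d / 2 : ℝ) * θ ≤ R ^ 2 / (4 * ν) ∧
      barrierK d ν A 1 θ + barrierG ν A 1 θ * (R / 2) ^ 2 < R ^ 2 / (4 * ν) / θ := by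
  have hb : 0 < R ^ 2 / (4 * ν) := by positivity
  have h1 : ∀ᶠ θ in 𝓝 (0:ℝ), (d / 2 : ℝ) * θ < R ^ 2 / (4 * ν) := by
    have : ContinuousAt (fun θ : ℝ => (d / 2 : ℝ) * θ) 0 := by fun_prop
    exact this.eventually_lt_const (by simpa using hb)
  have h2 : ∀ᶠ θ in 𝓝 (0:ℝ), θ * barrierK d ν A 1 θ + R ^ 2 / (16 * ν) + A * √θ * (R / 2) ^ 2
      < R ^ 2 / (4 * ν) := by
    have : ContinuousAt (fun θ : ℝ => θ * barrierK d ν A 1 θ + R ^ 2 / (16 * ν)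
        + A * √θ * (R / 2) ^ 2) 0 := by
      unfold barrierK
      fun_prop
    refine this.eventually_lt_const ?_
    simp only [Real.sqrt_zero, mul_zero, zero_mul, zero_add, add_zero]
    rw [div_lt_div_iff₀ (by positivity) (by positivity)]
    nlinarith [mul_pos (pow_pos hR 2) hν]
  filter_upwards [h1.filter_mono nhdsWithin_le_nhds, h2.filter_mono nhdsWithin_le_nhds,
    self_mem_nhdsWithin] with θ h1 h2 hθ
  refine ⟨h1.le, ?_⟩
  have hθ : 0 < θ := hθ
  rw [lt_div_iff₀ hθ]
  refine lt_of_eq_of_lt ?_ h2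
  have hq := Real.sqrt_pos.2 hθ
  have e : θ = √θ ^ 2 := (Real.sq_sqrt hθ.le).symm
  rw [barrierG]
  generalize barrierK d ν A 1 θ = k
  generalize √θ = v at *
  rw [e]
  field_simp
  ring

lemma integrable_gaussian_and_integral_eq {d : ℕ} (x₀ : Euc d) {ν s : ℝ} (hν : 0 < ν)
    (hs : 0 < s) :
    Integrable (fun x : Euc d => Real.exp (-(d / 2) * Real.log s - ‖x - x₀‖ ^ 2 / (4 * ν) / s)) ∧
    ∫ x : Euc d, Real.exp (-(d / 2) * Real.log s - ‖x - x₀‖ ^ 2 / (4 * ν) / s)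
      = (Real.pi * (4 * ν)) ^ (d / 2 : ℝ) := by
  have hb : 0 < 1 / (4 * ν * s) := by positivity
  have h1 := GaussianFourier.integral_rexp_neg_mul_sq_norm (V := Euc d) hb
  rw [finrank_euclideanSpace_fin, ← integral_sub_right_eq_self _ x₀] at h1
  have h2 : ∀ x : Euc d, Real.exp (-(d / 2) * Real.log s - ‖x - x₀‖ ^ 2 / (4 * ν) / s)
      = Real.exp (-(d / 2) * Real.log s) * Real.exp (-(1 / (4 * ν * s)) * ‖x - x₀‖ ^ 2) := by
    intro x
    rw [← Real.exp_add]
    congr 1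
    field_simp
    ring
  have h3 : ∫ x : Euc d, Real.exp (-(d / 2) * Real.log s - ‖x - x₀‖ ^ 2 / (4 * ν) / s)
      = (Real.pi * (4 * ν)) ^ (d / 2 : ℝ) := by
    simp only [h2]
    rw [integral_const_mul, h1]
    have e1 : Real.pi / (1 / (4 * ν * s)) = Real.pi * (4 * ν) * s := by field_simp
    rw [e1, Real.mul_rpow (by positivity) hs.le, Real.rpow_def_of_pos hs, mul_left_comm,
      ← Real.exp_add, mul_comm (Real.log s), neg_mul, neg_add_cancel, Real.exp_zero, mul_one]
  refine ⟨?_, h3⟩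
  by_contra hni
  rw [integral_undef hni] at h3
  have : 0 < (Real.pi * (4 * ν)) ^ (d / 2 : ℝ) := by positivity
  exact this.ne h3

/-- Local lower bound: mass in a ball propagates to a pointwise bound at the centre. -/
lemma eventually_exists_integral_le (d : ℕ) {ν ρ R : ℝ} (hν : 0 < ν) (hρ : 0 ≤ ρ) (hR : 0 < R) :
    ∀ᶠ θ in 𝓝[>] (0:ℝ), ∃ c > 0, ∀ (D : Set (Euc d)) (T : ℝ) (a : ℝ → Euc d → Euc d)
      (w : ℝ → Euc d → ℝ), IsOpen D → Bornology.IsBounded D → IsSol D ν T ρ a w →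
      ∀ t, 0 ≤ t → t + θ ≤ T → ∀ x, Metric.closedBall x R ⊆ D →
        c * ∫ y in Metric.ball x (R / 2), w t y ≤ w (t + θ) x := by
  set A := ρ / (4 * ν) with hA
  have hA0 : 0 ≤ A := by positivity
  filter_upwards [eventually_barrier_gap d A hν hR, self_mem_nhdsWithin] with θ ⟨hθ1, hθ2⟩ hθ
  have hθ : 0 < θ := hθ
  set m := Real.exp (-(d / 2) * Real.log θ - R ^ 2 / (4 * ν) / θ) with hm
  have hm0 : 0 < m := Real.exp_pos _
  set c₀ := softPos (Real.exp (logBarrier d ν A 1 θ ((R / 2) ^ 2)) - m) with hc₀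
  have hc₀0 : 0 < c₀ := by
    refine softPos_pos (sub_pos.2 (Real.exp_lt_exp.2 ?_))
    rw [logBarrier]
    linarith
  set G := (Real.pi * (4 * ν)) ^ (d / 2 : ℝ) with hG
  have hG0 : 0 < G := by positivity
  refine ⟨c₀ / G, by positivity, ?_⟩
  intro D T a w hD hb h t ht0 htT x₀ hx₀
  have hx₀D : x₀ ∈ D := hx₀ (Metric.mem_closedBall_self hR.le)
  have mt : t ∈ Icc 0 T := ⟨ht0, by linarith⟩
  have mtθ : t + θ ∈ Icc 0 T := ⟨by linarith, htT⟩
  have hcint : ∀ {h : Euc d → ℝ}, ContinuousOn h (closure D) → IntegrableOn h D := fun hh =>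
    (hh.integrableOn_compact hb.isCompact_closure).mono_set subset_closure
  have hfin : volume D ≠ ⊤ := hb.measure_lt_top.ne
  obtain ⟨W, hW0, hW⟩ := h.data.exists_bound isCompact_Icc hb
  have key : ∀ η > 0, c₀ * ∫ y in Metric.ball x₀ (R / 2), w t y ≤
      (w (t + θ) x₀ + η) * G + η := by
    intro η hη
    obtain ⟨δ, hδ, hδD, hδw⟩ := h.exists_ball_abs_sub_lt hD mtθ hx₀D hη
    have hev : ∀ᶠ s in 𝓝[>] (0:ℝ), s < θ ∧ s < δ ∧
        W * Real.exp (-(d / 2) * Real.log s - δ ^ 2 / (4 * ν) / s) * volume.real D < η := by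
      have h1 := ((tendsto_exp_neg_mul_log_sub_div (d / 2) (b := δ ^ 2 / (4 * ν))
        (by positivity)).const_mul W).mul_const (volume.real D)
      simp only [mul_zero, zero_mul] at h1
      filter_upwards [(eventually_lt_nhds hθ).filter_mono nhdsWithin_le_nhds,
        (eventually_lt_nhds hδ).filter_mono nhdsWithin_le_nhds, h1.eventually_lt_const hη]
        with s a b c using ⟨a, b, c⟩
    obtain ⟨s, ⟨hsθ, hsδ, hse⟩, hs0⟩ := (hev.and self_mem_nhdsWithin).exists
    have hs0 : 0 < s := hs0
    obtain ⟨φt, φ1, φ2, hφ, hsub⟩ := exists_lower_barrier D x₀ (t₁ := t) (t₁' := t + θ - s)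
      (t₂ := t + θ) m hν hρ (by linarith)
    have mts : t + θ - s ∈ Icc 0 T := ⟨by linarith, by linarith⟩
    have hle := h.integral_mul_le_of_subsolution hD hb ht0 (by linarith) mts.2 hφ
      (fun t' ht' => by
        refine ⟨Metric.closedBall x₀ R, isCompact_closedBall _ _, hx₀, fun x _ hx => ?_⟩
        have hr : R < ‖x - x₀‖ := by rwa [Metric.mem_closedBall, not_le, dist_eq_norm] at hx
        refine softPos_of_nonpos (sub_nonpos.2 (Real.exp_le_exp.2 ?_))
        have hp : 0 < t + θ - t' := by linarith [ht'.2]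
        refine (logBarrier_one_le hν hA0 hp (sq_nonneg _)).trans ?_
        refine le_trans ?_ (neg_mul_log_sub_div_le hp (by linarith [ht'.1]) (by positivity) hθ1)
        gcongr)
      (fun t' ht' x hx => hsub t' ht' x _ (h.norm_a_le ⟨by linarith [ht'.1],
        by linarith [ht'.2, mts.2]⟩ hx))
    have hsubR : Metric.ball x₀ (R / 2) ⊆ D := (Metric.ball_subset_closedBall.trans
      (Metric.closedBall_subset_closedBall (by linarith))).trans hx₀
    have hleft : c₀ * ∫ y in Metric.ball x₀ (R / 2), w t y ≤ ∫ x in D, w t x * softPos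
        (Real.exp (logBarrier d ν A 1 (t + θ - t) (‖x - x₀‖ ^ 2)) - m) := by
      have hi := hcint ((h.data.continuousOn_slice mt).mul
        (hφ.continuousOn_slice ⟨le_rfl, by linarith⟩))
      refine le_trans ?_ (setIntegral_mono_set hi ?_ hsubR.eventuallyLE)
      · rw [← integral_const_mul]
        refine setIntegral_mono_on (((h.data.integrableOn hb mt).mono_set hsubR).const_mul _)
          (hi.mono_set hsubR) measurableSet_ball fun x hx => ?_
        rw [mul_comm, add_sub_cancel_left]
        refine mul_le_mul_of_nonneg_left ?_ (h.nonneg _ mt x (subset_closure (hsubR hx)))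
        refine monotone_softPos (sub_le_sub_right (Real.exp_le_exp.2 ?_) _)
        have h0 : 0 ≤ barrierG ν A 1 θ := by rw [barrierG]; positivity
        rw [Metric.mem_ball, dist_eq_norm] at hx
        rw [logBarrier, logBarrier]
        gcongr
      · filter_upwards [ae_restrict_mem hD.measurableSet] with x hx
        exact mul_nonneg (h.nonneg _ mt x (subset_closure hx)) (softPos_nonneg _)
    have hright : ∫ x in D, w (t + θ - s) x * softPos
        (Real.exp (logBarrier d ν A 1 (t + θ - (t + θ - s)) (‖x - x₀‖ ^ 2)) - m)
        ≤ (w (t + θ) x₀ + η) * G + η := by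
      obtain ⟨g1, g2⟩ := integrable_gaussian_and_integral_eq x₀ hν hs0
      have hw0 : 0 ≤ w (t + θ) x₀ + η := by
        have := h.nonneg _ mtθ x₀ (subset_closure hx₀D)
        linarith
      have b1 : ∫ x in D, w (t + θ - s) x * softPos
          (Real.exp (logBarrier d ν A 1 (t + θ - (t + θ - s)) (‖x - x₀‖ ^ 2)) - m) ≤
          ∫ x in D, ((w (t + θ) x₀ + η) *
            Real.exp (-(d / 2) * Real.log s - ‖x - x₀‖ ^ 2 / (4 * ν) / s)
            + W * Real.exp (-(d / 2) * Real.log s - δ ^ 2 / (4 * ν) / s)) := by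
        refine setIntegral_mono_on (hcint ((h.data.continuousOn_slice mts).mul
          (hφ.continuousOn_slice ⟨by linarith, le_rfl⟩)))
          ((g1.integrableOn.const_mul _).add (integrableOn_const hfin)) hD.measurableSet
          fun x hx => ?_
        rw [sub_sub_cancel]
        have p1 : softPos (Real.exp (logBarrier d ν A 1 s (‖x - x₀‖ ^ 2)) - m) ≤
            Real.exp (-(d / 2) * Real.log s - ‖x - x₀‖ ^ 2 / (4 * ν) / s) := by
          refine (softPos_le_max _).trans (max_le ?_ (Real.exp_pos _).le)
          have := Real.exp_le_exp.2 (logBarrier_one_le (d := d) hν hA0 hs0 (sq_nonneg ‖x - x₀‖))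
          linarith
        have p2 := h.nonneg _ mts x (subset_closure hx)
        have p3 := softPos_nonneg (Real.exp (logBarrier d ν A 1 s (‖x - x₀‖ ^ 2)) - m)
        by_cases hxδ : x ∈ Metric.ball x₀ δ
        · have p4 := (abs_lt.1 (hδw _ mts (by rw [abs_lt]; constructor <;> linarith) x hxδ)).2
          refine le_add_of_le_of_nonneg ?_ (by positivity)
          exact mul_le_mul (by linarith) p1 p3 hw0
        · rw [Metric.mem_ball, not_lt, dist_eq_norm] at hxδ
          refine le_add_of_nonneg_of_le (by positivity) ?_
          refine mul_le_mul ((le_abs_self _).trans (hW _ mts x (subset_closure hx)))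
            (p1.trans (Real.exp_le_exp.2 ?_)) p3 hW0
          gcongr
      have b2 : ∫ x in D, Real.exp (-(d / 2) * Real.log s - ‖x - x₀‖ ^ 2 / (4 * ν) / s) ≤ G := by
        rw [hG, ← g2]
        exact setIntegral_le_integral g1 (Eventually.of_forall fun x => (Real.exp_pos _).le)
      rw [integral_add (g1.integrableOn.const_mul _) (integrableOn_const hfin),
        integral_const_mul, setIntegral_const, smul_eq_mul] at b1
      have b3 := mul_le_mul_of_nonneg_left b2 hw0
      linarith
    exact (hleft.trans hle).trans hright
  have hlim : Tendsto (fun η => (w (t + θ) x₀ + η) * G + η) (𝓝[>] 0)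
      (𝓝 ((w (t + θ) x₀ + 0) * G + 0)) :=
    (Continuous.tendsto (by fun_prop) 0).mono_left nhdsWithin_le_nhds
  have hfinal := ge_of_tendsto hlim (by
    filter_upwards [self_mem_nhdsWithin] with η hη using key η hη)
  rw [add_zero, add_zero] at hfinal
  rw [div_mul_eq_mul_div, div_le_iff₀ hG0]
  exact hfinal

/-- For every small enough `θ`, the mass on `A` of a solution bounds the solution on `B` from
below after time `θ`, uniformly over all solutions. -/
def Spreads {d : ℕ} (D : Set (Euc d)) (ν T ρ : ℝ) (A B : Set (Euc d)) : Prop :=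
  ∀ᶠ θ in 𝓝[>] (0:ℝ), ∃ c > 0, ∀ (a : ℝ → Euc d → Euc d) (w : ℝ → Euc d → ℝ),
    IsSol D ν T ρ a w → ∀ t, 0 ≤ t → t + θ ≤ T → ∀ y ∈ B, c * ∫ x in A, w t x ≤ w (t + θ) y

namespace Spreads

variable {d : ℕ} {D : Set (Euc d)} {ν T ρ : ℝ} {A A₁ A₂ B B₁ B₂ : Set (Euc d)}

lemma empty_left (hB : B ⊆ D) : Spreads D ν T ρ ∅ B := by
  filter_upwards [self_mem_nhdsWithin] with θ hθ
  have hθ : 0 < θ := hθ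
  refine ⟨1, one_pos, fun a w h t ht hT y hy => ?_⟩
  simpa using h.nonneg _ ⟨by linarith, hT⟩ y (subset_closure (hB hy))

lemma empty_right : Spreads D ν T ρ A ∅ :=
  Eventually.of_forall fun _ => ⟨1, one_pos, fun _ _ _ _ _ _ _ hy => hy.elim⟩

lemma mono_right (h : Spreads D ν T ρ A B₂) (hB : B₁ ⊆ B₂) : Spreads D ν T ρ A B₁ := by
  filter_upwards [h] with θ ⟨c, hc, hh⟩
  exact ⟨c, hc, fun a w hw t ht hT y hy => hh a w hw t ht hT y (hB hy)⟩

lemma mono_left (h : Spreads D ν T ρ A₂ B) (hA : A₁ ⊆ A₂) (hA₂ : A₂ ⊆ D) (hD : IsOpen D)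
    (hb : Bornology.IsBounded D) : Spreads D ν T ρ A₁ B := by
  filter_upwards [h, self_mem_nhdsWithin] with θ ⟨c, hc, hh⟩ hθ
  have hθ : 0 < θ := hθ
  refine ⟨c, hc, fun a w hw t ht hT y hy => le_trans ?_ (hh a w hw t ht hT y hy)⟩
  have mt : t ∈ Icc 0 T := ⟨ht, by linarith⟩
  refine mul_le_mul_of_nonneg_left (setIntegral_mono_set
    ((hw.data.integrableOn hb mt).mono_set hA₂) ?_ hA.eventuallyLE) hc.le
  refine ae_restrict_of_ae_restrict_of_subset hA₂ ?_
  filter_upwards [ae_restrict_mem hD.measurableSet] with x hx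
  exact hw.nonneg _ mt x (subset_closure hx)

lemma union_right (h₁ : Spreads D ν T ρ A B₁) (h₂ : Spreads D ν T ρ A B₂) (hA : A ⊆ D)
    (hD : IsOpen D) : Spreads D ν T ρ A (B₁ ∪ B₂) := by
  filter_upwards [h₁, h₂, self_mem_nhdsWithin] with θ ⟨c₁, hc₁, hh₁⟩ ⟨c₂, hc₂, hh₂⟩ hθ
  have hθ : 0 < θ := hθ
  refine ⟨min c₁ c₂, lt_min hc₁ hc₂, fun a w hw t ht hT y hy => ?_⟩
  have hI : 0 ≤ ∫ x in A, w t x := by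
    refine integral_nonneg_of_ae (ae_restrict_of_ae_restrict_of_subset hA ?_)
    filter_upwards [ae_restrict_mem hD.measurableSet] with x hx
    exact hw.nonneg _ ⟨ht, by linarith⟩ x (subset_closure hx)
  rcases hy with hy | hy
  · exact (mul_le_mul_of_nonneg_right (min_le_left _ _) hI).trans (hh₁ a w hw t ht hT y hy)
  · exact (mul_le_mul_of_nonneg_right (min_le_right _ _) hI).trans (hh₂ a w hw t ht hT y hy)

lemma union_left (h₁ : Spreads D ν T ρ A₁ B) (h₂ : Spreads D ν T ρ A₂ B) (hA₁ : A₁ ⊆ D)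
    (hA₂ : A₂ ⊆ D) (hD : IsOpen D) (hb : Bornology.IsBounded D) :
    Spreads D ν T ρ (A₁ ∪ A₂) B := by
  filter_upwards [h₁, h₂, self_mem_nhdsWithin] with θ ⟨c₁, hc₁, hh₁⟩ ⟨c₂, hc₂, hh₂⟩ hθ
  have hθ : 0 < θ := hθ
  refine ⟨min c₁ c₂ / 2, by positivity, fun a w hw t ht hT y hy => ?_⟩
  have mt : t ∈ Icc 0 T := ⟨ht, by linarith⟩
  have hpos : ∀ {A : Set (Euc d)}, A ⊆ D → 0 ≤ᵐ[volume.restrict A] w t := fun hA => by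
    refine ae_restrict_of_ae_restrict_of_subset hA ?_
    filter_upwards [ae_restrict_mem hD.measurableSet] with x hx
    exact hw.nonneg _ mt x (subset_closure hx)
  have hi := hw.data.integrableOn hb mt
  have hunion : ∫ x in A₁ ∪ A₂, w t x ≤ (∫ x in A₁, w t x) + ∫ x in A₂, w t x := by
    rw [← integral_add_measure (hi.mono_set hA₁) (hi.mono_set hA₂)]
    exact integral_mono_measure (Measure.restrict_union_le _ _)
      (ae_add_measure_iff.2 ⟨hpos hA₁, hpos hA₂⟩)
      (integrable_add_measure.2 ⟨hi.mono_set hA₁, hi.mono_set hA₂⟩)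
  have e₁ := hh₁ a w hw t ht hT y hy
  have e₂ := hh₂ a w hw t ht hT y hy
  have i₁ := integral_nonneg_of_ae (hpos hA₁)
  have i₂ := integral_nonneg_of_ae (hpos hA₂)
  have f₁ := mul_le_mul_of_nonneg_right (min_le_left c₁ c₂) i₁
  have f₂ := mul_le_mul_of_nonneg_right (min_le_right c₁ c₂) i₂
  have f := mul_le_mul_of_nonneg_left hunion (by positivity : 0 ≤ min c₁ c₂ / 2)
  linarith

lemma trans (h₁ : Spreads D ν T ρ A₁ B₁) (h₂ : Spreads D ν T ρ A₂ B₂) (hA₂ : A₂ ⊆ D)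
    (hA₂o : IsOpen A₂) (hB₁ : IsOpen B₁) (hne : (A₂ ∩ B₁).Nonempty) (hD : IsOpen D)
    (hb : Bornology.IsBounded D) : Spreads D ν T ρ A₁ B₂ := by
  have hhalf : Tendsto (fun θ : ℝ => θ / 2) (𝓝[>] 0) (𝓝[>] 0) := by
    refine tendsto_nhdsWithin_iff.2 ⟨?_, ?_⟩
    · have : Tendsto (fun θ : ℝ => θ / 2) (𝓝 0) (𝓝 (0 / 2)) :=
        Continuous.tendsto (by fun_prop) 0
      rw [zero_div] at this
      exact this.mono_left nhdsWithin_le_nhds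
    · filter_upwards [self_mem_nhdsWithin] with θ hθ using half_pos (mem_Ioi.1 hθ)
  filter_upwards [hhalf.eventually h₁, hhalf.eventually h₂, self_mem_nhdsWithin]
    with θ ⟨c₁, hc₁, hh₁⟩ ⟨c₂, hc₂, hh₂⟩ hθ
  have hθ : 0 < θ := hθ
  have hfin : volume (A₂ ∩ B₁) ≠ ⊤ :=
    (hb.subset (inter_subset_left.trans hA₂)).measure_lt_top.ne
  have hvol : 0 < volume.real (A₂ ∩ B₁) :=
    ENNReal.toReal_pos ((hA₂o.inter hB₁).measure_pos volume hne).ne' hfin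
  refine ⟨c₂ * (volume.real (A₂ ∩ B₁) * c₁), by positivity, fun a w hw t ht hT y hy => ?_⟩
  have mt : t + θ / 2 ∈ Icc 0 T := ⟨by linarith, by linarith⟩
  have hi := (hw.data.integrableOn hb mt).mono_set hA₂
  have e₂ := hh₂ a w hw (t + θ / 2) mt.1 (by linarith) y hy
  rw [add_assoc, add_halves] at e₂
  refine le_trans ?_ e₂
  rw [mul_assoc, mul_assoc]
  refine mul_le_mul_of_nonneg_left ?_ hc₂.le
  calc volume.real (A₂ ∩ B₁) * (c₁ * ∫ x in A₁, w t x)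
      = ∫ _ in A₂ ∩ B₁, c₁ * ∫ x in A₁, w t x := by rw [setIntegral_const, smul_eq_mul]
    _ ≤ ∫ x in A₂ ∩ B₁, w (t + θ / 2) x :=
        setIntegral_mono_on (integrableOn_const hfin) (hi.mono_set inter_subset_left)
          (hA₂o.inter hB₁).measurableSet fun x hx => hh₁ a w hw t ht (by linarith) x hx.2
    _ ≤ ∫ x in A₂, w (t + θ / 2) x := by
        refine setIntegral_mono_set hi ?_ inter_subset_left.eventuallyLE
        refine ae_restrict_of_ae_restrict_of_subset hA₂ ?_
        filter_upwards [ae_restrict_mem hD.measurableSet] with x hx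
        exact hw.nonneg _ mt x (subset_closure hx)

lemma exists_ball (hν : 0 < ν) (hρ : 0 ≤ ρ) (hD : IsOpen D) (hb : Bornology.IsBounded D)
    {x : Euc d} (hx : x ∈ D) :
    ∃ r > 0, Metric.ball x r ⊆ D ∧ Spreads D ν T ρ (Metric.ball x r) (Metric.ball x r) := by
  obtain ⟨R, hR, hRD⟩ := Metric.nhds_basis_closedBall.mem_iff.1 (hD.mem_nhds hx)
  have hsub : Metric.ball x (R / 8) ⊆ D :=
    (Metric.ball_subset_closedBall.trans (Metric.closedBall_subset_closedBall (by linarith))).trans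
      hRD
  refine ⟨R / 8, by positivity, hsub, ?_⟩
  filter_upwards [eventually_exists_integral_le d hν hρ (half_pos hR), self_mem_nhdsWithin]
    with θ ⟨c, hc, hh⟩ hθ
  have hθ : 0 < θ := hθ
  refine ⟨c, hc, fun a w hw t ht hT y hy => ?_⟩
  rw [Metric.mem_ball] at hy
  have hyD : Metric.closedBall y (R / 2) ⊆ D :=
    (Metric.closedBall_subset_closedBall' (by linarith)).trans hRD
  refine le_trans ?_ (hh D T a w hD hb hw t ht hT y hyD)
  have mt : t ∈ Icc 0 T := ⟨ht, by linarith⟩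
  have hyD' : Metric.ball y (R / 2 / 2) ⊆ D := (Metric.ball_subset_closedBall.trans
    (Metric.closedBall_subset_closedBall (by linarith))).trans hyD
  refine mul_le_mul_of_nonneg_left (setIntegral_mono_set
    ((hw.data.integrableOn hb mt).mono_set hyD') ?_ (LE.le.eventuallyLE ?_)) hc.le
  · refine ae_restrict_of_ae_restrict_of_subset hyD' ?_
    filter_upwards [ae_restrict_mem hD.measurableSet] with x hx
    exact hw.nonneg _ mt x (subset_closure hx)
  · exact Metric.ball_subset_ball' (by rw [dist_comm]; linarith)

lemma exists_isOpen (hν : 0 < ν) (hρ : 0 ≤ ρ) (hD : IsOpen D) (hc : IsPreconnected D)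
    (hb : Bornology.IsBounded D) {x y : Euc d} (hx : x ∈ D) (hy : y ∈ D) :
    ∃ A B, IsOpen A ∧ IsOpen B ∧ x ∈ A ∧ y ∈ B ∧ A ⊆ D ∧ B ⊆ D ∧ Spreads D ν T ρ A B := by
  refine hc.induction₂' (fun x y => ∃ A B, IsOpen A ∧ IsOpen B ∧ x ∈ A ∧ y ∈ B ∧ A ⊆ D ∧ B ⊆ D ∧
    Spreads D ν T ρ A B) ?_ ?_ hx hy
  · intro z hz
    obtain ⟨r, hr, hrD, hS⟩ := exists_ball (T := T) hν hρ hD hb hz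
    filter_upwards [mem_nhdsWithin_of_mem_nhds (Metric.ball_mem_nhds z hr)] with y hy
    have hz' := Metric.mem_ball_self (x := z) hr
    exact ⟨⟨_, _, Metric.isOpen_ball, Metric.isOpen_ball, hz', hy, hrD, hrD, hS⟩,
      ⟨_, _, Metric.isOpen_ball, Metric.isOpen_ball, hy, hz', hrD, hrD, hS⟩⟩
  · rintro x y z - - - ⟨A, B, hA, hB, hxA, hyB, hAD, hBD, h⟩
      ⟨A', B', hA', hB', hyA', hzB', hAD', hBD', h'⟩
    exact ⟨A, B', hA, hB', hxA, hzB', hAD, hBD', h.trans h' hAD' hA' hB ⟨y, hyA', hyB⟩ hD hb⟩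

lemma of_isCompact (hν : 0 < ν) (hρ : 0 ≤ ρ) (hD : IsOpen D) (hc : IsPreconnected D)
    (hb : Bornology.IsBounded D) {K L : Set (Euc d)} (hK : IsCompact K) (hL : IsCompact L)
    (hKD : K ⊆ D) (hLD : L ⊆ D) : Spreads D ν T ρ K L := by
  have hpoint : ∀ y ∈ D, ∃ B, IsOpen B ∧ y ∈ B ∧ B ⊆ D ∧ Spreads D ν T ρ (K ∩ D) B := by
    intro y hy
    refine hK.induction_on (p := fun S => ∃ B, IsOpen B ∧ y ∈ B ∧ B ⊆ D ∧
      Spreads D ν T ρ (S ∩ D) B) ?_ ?_ ?_ ?_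
    · exact ⟨D, hD, hy, Subset.rfl, by simpa using empty_left Subset.rfl⟩
    · rintro s t hst ⟨B, hB, hyB, hBD, h⟩
      exact ⟨B, hB, hyB, hBD, h.mono_left (inter_subset_inter_left _ hst) inter_subset_right hD hb⟩
    · rintro s t ⟨B, hB, hyB, hBD, h⟩ ⟨B', hB', hyB', hBD', h'⟩
      refine ⟨B ∩ B', hB.inter hB', ⟨hyB, hyB'⟩, inter_subset_left.trans hBD, ?_⟩
      rw [union_inter_distrib_right]
      exact (h.mono_right inter_subset_left).union_left (h'.mono_right inter_subset_right)
        inter_subset_right inter_subset_right hD hb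
    · intro x hx
      obtain ⟨A, B, hA, hB, hxA, hyB, hAD, hBD, h⟩ :=
        exists_isOpen (T := T) hν hρ hD hc hb (hKD hx) hy
      refine ⟨A, mem_nhdsWithin_of_mem_nhds (hA.mem_nhds hxA), B, hB, hyB, hBD, ?_⟩
      exact h.mono_left inter_subset_left hAD hD hb
  rw [inter_eq_self_of_subset_left hKD] at hpoint
  refine hL.induction_on (p := fun S => Spreads D ν T ρ K S) empty_right
    (fun s t hst h => h.mono_right hst) (fun s t h h' => h.union_right h' hKD hD) ?_
  intro y hy
  obtain ⟨B, hB, hyB, -, h⟩ := hpoint y (hLD hy)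
  exact ⟨B, mem_nhdsWithin_of_mem_nhds (hB.mem_nhds hyB), h⟩

end Spreads

lemma lapl_eq_trace2 {d : ℕ} (f : Euc d → ℝ) (x : Euc d) : lapl f x = trace2 (dx2 f x) := rfl

lemma divAW_eq {d : ℕ} {a : ℝ → Euc d → Euc d} {w : ℝ → Euc d → ℝ} {t : ℝ} {x : Euc d}
    (ha : DifferentiableAt ℝ (a t) x) (hw : DifferentiableAt ℝ (w t) x) :
    divAW a w t x = dx1 (w t) x (a t x) + w t x * traceEnd (fderiv ℝ (a t) x) := by
  rw [divAW, ← sum_apply_ebasis_mul (dx1 (w t) x) (a t x), traceEnd, Finset.mul_sum,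
    ← Finset.sum_add_distrib]
  refine Finset.sum_congr rfl fun j _ => ?_
  have h1 : HasFDerivAt (fun y => a t y j)
      ((EuclideanSpace.proj j : Euc d →L[ℝ] ℝ).comp (fderiv ℝ (a t) x)) x :=
    (EuclideanSpace.proj j : Euc d →L[ℝ] ℝ).hasFDerivAt.comp x ha.hasFDerivAt
  have h2 : HasFDerivAt (fun y => a t y j * w t y) _ x := h1.mul hw.hasFDerivAt
  rw [h2.fderiv]
  rfl

lemma IsC12On.c12Data {d : ℕ} {J : Set ℝ} {D : Set (Euc d)} {w : ℝ → Euc d → ℝ}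
    (h : IsC12On J D w) : C12Data J D w (fun t x => dtt w t x) (fun t x => dx1 (w t) x)
      (fun t x => dx2 (w t) x) := by
  obtain ⟨h1, h2, h3, h4, h5, h6, h7⟩ := h
  exact ⟨fun t ht x hx => (h2 x (subset_closure hx) t ht).hasDerivAt,
    fun t ht x hx => (h3 t ht x (subset_closure hx)).hasFDerivAt,
    fun t ht x hx => (h4 t ht x (subset_closure hx)).hasFDerivAt, h1, h5, h6, h7⟩

lemma IsSol.L1norm_eq {d : ℕ} {D : Set (Euc d)} {ν T ρ : ℝ} {a : ℝ → Euc d → Euc d}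
    {w : ℝ → Euc d → ℝ} (h : IsSol D ν T ρ a w) (hD : IsOpen D) {t : ℝ} (ht : t ∈ Icc 0 T) :
    L1norm D (w t) = ∫ x in D, w t x :=
  setIntegral_congr_fun hD.measurableSet fun x hx =>
    abs_of_nonneg (h.nonneg t ht x (subset_closure hx))

/-- Step 1 of the proof of Proposition 2.3: for nonnegative solutions of the
linear problem, for any `q ∈ (0,1)` there is `ε > 0` such that either the `L¹` norm squeezes by
the factor `q`, or `w(T,·) ≥ ε ‖w(0,·)‖_{L¹}` on `Π`. -/
theorem stmt_10 {d : ℕ} (D Pia : Set (Euc d)) (hD : GoodDomain D)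
    (hP : IsOpen Pia ∧ closure Pia ⊆ D)
    (ν T ρ : ℝ) (hν : 0 < ν) (hT : 0 < T) (hρ : 0 < ρ) :
    ∀ q ∈ Ioo (0:ℝ) 1, ∃ ε : ℝ, 0 < ε ∧
      ∀ a : ℝ → Euc d → Euc d,
        ContinuousOn (fun p : ℝ × Euc d => a p.1 p.2) (Icc 0 T ×ˢ closure D) →
        (∀ t ∈ Icc (0:ℝ) T, ∀ x ∈ closure D, DifferentiableAt ℝ (a t) x) →
        ContinuousOn (fun p : ℝ × Euc d => fderiv ℝ (a p.1) p.2) (Icc 0 T ×ˢ closure D) →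
        (∀ t ∈ Icc (0:ℝ) T, ∀ x ∈ D, ‖a t x‖ + ‖fderiv ℝ (a t) x‖ ≤ ρ) →
        ∀ w : ℝ → Euc d → ℝ, IsC12On (Icc 0 T) D w →
          (∀ t ∈ Icc (0:ℝ) T, ∀ x ∈ closure D, 0 ≤ w t x) →
          (∀ t ∈ Icc (0:ℝ) T, ∀ x ∈ D, dtt w t x - ν * lapl (w t) x + divAW a w t x = 0) →
          DirichletBC (Icc 0 T) D w →
          L1norm D (w T) ≤ q * L1norm D (w 0) ∨
            ∀ x ∈ Pia, ε * L1norm D (w 0) ≤ w T x := by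
  obtain ⟨hDo, hDc, hb, -⟩ := hD
  rintro q ⟨hq, -⟩
  set τ := min (T / 2) (1 / ρ ^ 2) with hτ
  have hτ0 : 0 < τ := by positivity
  have hρτ : ρ * √τ ≤ 1 := by
    have : √τ ≤ 1 / ρ := by
      refine Real.sqrt_le_iff.2 ⟨by positivity, ?_⟩
      rw [div_pow, one_pow]
      exact min_le_right _ _
    calc ρ * √τ ≤ ρ * (1 / ρ) := by gcongr
      _ = 1 := by field_simp
  obtain ⟨C, hC, hupper⟩ := exists_pointwise_le_integral d hν hρ.le hτ0 hρτ
  have hfin : volume D ≠ ⊤ := hb.measure_lt_top.ne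
  obtain ⟨K, hKD, hK, hKv⟩ := hDo.measurableSet.exists_isCompact_sdiff_lt (μ := volume) hfin
    (ε := ENNReal.ofReal (q / (2 * C))) (by simpa using by positivity)
  have hKv' : volume.real (D \ K) ≤ q / (2 * C) :=
    ENNReal.toReal_le_of_le_ofReal (by positivity) hKv.le
  have hL : IsCompact (closure Pia) :=
    (hb.subset (subset_closure.trans hP.2)).isCompact_closure
  have hS := Spreads.of_isCompact (T := T) hν hρ.le hDo hDc.isPreconnected hb hK hL hKD hP.2
  obtain ⟨θ, ⟨⟨c, hc, hlower⟩, hθT⟩, hθ⟩ := ((hS.and ((eventually_lt_nhds (half_pos hT)).filter_mono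
    nhdsWithin_le_nhds)).and self_mem_nhdsWithin).exists
  have hθ : 0 < θ := hθ
  refine ⟨c * (q / 2), by positivity, ?_⟩
  intro a ha1 ha2 ha3 ha4 w hw hw0 hpde hbc
  have hsol : IsSol D ν T ρ a w := ⟨ha1, ha2, ha3, ha4, hw.c12Data, hw0, fun t ht x hx => by
    rw [← hpde t ht x hx, divAW_eq (ha2 t ht x (subset_closure hx))
      (hw.2.2.1 t ht x (subset_closure hx)), lapl_eq_trace2]
    ring, hbc⟩
  rw [or_iff_not_imp_left, not_le]
  intro hlt x hx
  have m0 : (0:ℝ) ∈ Icc 0 T := ⟨le_rfl, hT.le⟩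
  have mT : T ∈ Icc 0 T := ⟨hT.le, le_rfl⟩
  have m1 : T - θ ∈ Icc 0 T := ⟨by linarith, by linarith⟩
  rw [hsol.L1norm_eq hDo m0] at hlt ⊢
  rw [hsol.L1norm_eq hDo mT] at hlt
  set M := ∫ x in D, w 0 x with hM
  have hM0 : 0 ≤ M := setIntegral_nonneg hDo.measurableSet fun x hx =>
    hw0 0 m0 x (subset_closure hx)
  have hmass := hsol.integral_antitone hν hDo hb m1.1 m1.2 le_rfl
  have hτT : τ ≤ T - θ := by
    have := min_le_left (T / 2) (1 / ρ ^ 2)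
    linarith
  have hi := hsol.data.integrableOn hb m1
  have hpt : ∀ x ∈ D, w (T - θ) x ≤ C * M := fun x hx =>
    (hupper D T a w hDo hb hsol (T - θ) hτT m1.2 x hx).trans (mul_le_mul_of_nonneg_left
      (hsol.integral_antitone hν hDo hb le_rfl (by linarith) (by linarith)) hC.le)
  have hout : ∫ x in D \ K, w (T - θ) x ≤ q / 2 * M := by
    calc ∫ x in D \ K, w (T - θ) x ≤ ∫ _ in D \ K, C * M :=
          setIntegral_mono_on (hi.mono_set sdiff_subset)
            (integrableOn_const (measure_ne_top_of_subset sdiff_subset hfin))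
            (hDo.measurableSet.diff hK.measurableSet) fun x hx => hpt x hx.1
      _ = volume.real (D \ K) * (C * M) := by rw [setIntegral_const, smul_eq_mul]
      _ ≤ q / (2 * C) * (C * M) := by gcongr
      _ = q / 2 * M := by field_simp
  rw [setIntegral_sdiff hK.measurableSet hi hKD] at hout
  have hin : q / 2 * M ≤ ∫ x in K, w (T - θ) x := by linarith
  have hfinal := hlower a w hsol (T - θ) m1.1 (by linarith) x (subset_closure hx)
  rw [sub_add_cancel] at hfinal
  refine le_trans ?_ hfinal
  rw [mul_assoc]
  gcongr

end
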